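/- arXiv:2108.08634 — 7 statements merged into one kernel-verified Lean document; each statement's English description precedes it below -/
import Mathlib

section
/- For integers k_1 ≥ 2 and k_2,...,k_r ≥ 1, the limit as q → 1 from the left (q real, 0 < q < 1) of (1−q)^{k_1+⋯+k_r} · g_q(k_1,...,k_r) equals the multiple zeta value ζ(k_1,...,k_r). In other words, g(k_1,...,k_r) is a modified q-analogue of weight k_1+⋯+k_r of ζ(k_1,...,k_r). -/
/-- The multiple zeta value `ζ(k₁,…,k_r) = ∑_{m₁ > … > m_r > 0} 1/(m₁^{k₁} ⋯ m_r^{k_r})`,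
defined as a `tsum` over tuples of natural numbers (the index `0 : Fin r` corresponds
to `k₁`). -/
noncomputable def mzv (r : ℕ) (k : Fin r → ℕ) : ℝ :=
  ∑' m : Fin r → ℕ,
    if (∀ i j : Fin r, i < j → m j < m i) ∧ (∀ i, 1 ≤ m i) then
      ∏ i, ((m i : ℝ) ^ k i)⁻¹ else 0

/-- The `q`-analogue `g_q(k₁,…,k_r) = ∑ (∏ᵢ nᵢ^{kᵢ-1}/(kᵢ-1)!) q^{m₁n₁+⋯+m_rn_r}`, the sum
running over all tuples `m₁ > … > m_r > 0` and `n₁,…,n_r > 0`. -/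
noncomputable def gq (q : ℝ) (r : ℕ) (k : Fin r → ℕ) : ℝ :=
  ∑' p : (Fin r → ℕ) × (Fin r → ℕ),
    if (∀ i j : Fin r, i < j → p.1 j < p.1 i) ∧ (∀ i, 1 ≤ p.1 i) ∧ (∀ i, 1 ≤ p.2 i) then
      (∏ i, (p.2 i : ℝ) ^ (k i - 1) / (Nat.factorial (k i - 1))) * q ^ (∑ i, p.1 i * p.2 i)
    else 0

open Finset Filter Topology

theorem hasSum_pi_prod_of_nonneg {r : ℕ} {f : Fin r → ℕ → ℝ} {a : Fin r → ℝ}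
    (hf : ∀ i n, 0 ≤ f i n) (hs : ∀ i, HasSum (f i) (a i)) :
    HasSum (fun n : Fin r → ℕ => ∏ i, f i (n i)) (∏ i, a i) := by
  induction r with
  | zero => simp
  | succ r ih =>
    have ih := @ih (fun i => f i.succ) (fun i => a i.succ) (fun i => hf i.succ) fun i => hs i.succ
    have hpos : 0 ≤ fun n : Fin r → ℕ => ∏ i, f (Fin.succ i) (n i) :=
      Pi.le_def.2 fun n => prod_nonneg fun i _ => hf i.succ (n i)
    have hsum := Summable.mul_of_nonneg (hs 0).summable ih.summable
    have h := HasSum.mul (hs 0) ih (hsum (Pi.le_def.2 (hf 0)) hpos)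
    rw [← (Fin.consEquiv fun _ => ℕ).hasSum_iff, Fin.prod_univ_succ]
    convert! h using 1
    ext x
    simp [Fin.prod_univ_succ, Fin.consEquiv]

theorem card_mul_pow_le_geom_sum {q : ℝ} (h0 : 0 ≤ q) (h1 : q ≤ 1) (m : ℕ) :
    m * q ^ m ≤ ∑ i ∈ range m, q ^ i := by
  simpa using card_nsmul_le_sum (range m) (fun i => q ^ i) (q ^ m)
    fun i hi => pow_le_pow_of_le_one h0 h1 (mem_range.1 hi).le

theorem sq_mul_pow_le_sq_geom_sum {q : ℝ} (h0 : 0 ≤ q) (h1 : q ≤ 1) (m : ℕ) :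
    (m : ℝ) ^ 2 * q ^ m ≤ (∑ i ∈ range m, q ^ i) ^ 2 := by
  set s := √q
  have hs0 : 0 ≤ s := Real.sqrt_nonneg q
  have hs1 : s ≤ 1 := Real.sqrt_le_one.2 h1
  have hq : q = s ^ 2 := (Real.sq_sqrt h0).symm
  have h : m * s ^ m ≤ ∑ i ∈ range m, q ^ i := by
    have hr := sum_range_reflect (fun i => q ^ i) m
    have : m * (2 * s ^ m) ≤ ∑ i ∈ range m, (q ^ i + q ^ (m - 1 - i)) := by
      have := card_nsmul_le_sum (range m) (fun i => q ^ i + q ^ (m - 1 - i)) (2 * s ^ m) ?_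
      · simpa using this
      intro i hi
      have hi := mem_range.1 hi
      have h2 : s ^ m ≤ s ^ i * s ^ (m - 1 - i) := by
        rw [← pow_add]
        exact pow_le_pow_of_le_one hs0 hs1 (by omega)
      rw [hq, pow_right_comm s 2 i, pow_right_comm s 2 (m - 1 - i)]
      nlinarith [sq_nonneg (s ^ i - s ^ (m - 1 - i))]
    rw [sum_add_distrib, hr] at this
    linarith
  calc (m : ℝ) ^ 2 * q ^ m = (m * s ^ m) ^ 2 := by rw [hq]; ring
    _ ≤ _ := by gcongr

theorem one_le_geom_sum {q : ℝ} (h0 : 0 ≤ q) {m : ℕ} (hm : 1 ≤ m) :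
    1 ≤ ∑ i ∈ range m, q ^ i := by
  simpa using single_le_sum (f := fun i => q ^ i) (fun i _ => pow_nonneg h0 i) (mem_range.2 hm)

/-- The summand of `∑_{n ≥ 1} n^{k-1}/(k-1)! x^n`. -/
noncomputable def polylogTerm (k : ℕ) (x : ℝ) (n : ℕ) : ℝ :=
  if 1 ≤ n then (n : ℝ) ^ (k - 1) / (k - 1).factorial * x ^ n else 0

theorem polylogTerm_nonneg (k : ℕ) {x : ℝ} (hx : 0 ≤ x) (n : ℕ) : 0 ≤ polylogTerm k x n := by
  unfold polylogTerm
  split_ifs <;> positivity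

theorem polylogTerm_succ_le (k : ℕ) {x : ℝ} (hx : 0 ≤ x) (n : ℕ) :
    polylogTerm k x (n + 1) ≤ x * ((n + (k - 1)).choose (k - 1) * x ^ n) := by
  have h : ((n + 1 : ℕ) : ℝ) ^ (k - 1) / (k - 1).factorial ≤ (n + (k - 1)).choose (k - 1) := by
    rw [div_le_iff₀ (by positivity), mul_comm]
    have := Nat.pow_succ_le_ascFactorial (n + 1) (k - 1)
    rw [Nat.ascFactorial_eq_factorial_mul_choose] at this
    exact_mod_cast this
  have := mul_le_mul_of_nonneg_right h (pow_nonneg hx (n + 1))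
  simp only [polylogTerm, Nat.le_add_left, if_true]
  calc _ ≤ _ := this
    _ = _ := by ring

theorem le_polylogTerm_add {k : ℕ} (hk : 1 ≤ k) {x : ℝ} (hx : 0 ≤ x) (n : ℕ) :
    x ^ k * ((n + (k - 1)).choose (k - 1) * x ^ n) ≤ polylogTerm k x (n + k) := by
  have h : ((n + (k - 1)).choose (k - 1) : ℝ) ≤ ((n + k : ℕ) : ℝ) ^ (k - 1) / (k - 1).factorial :=
    (Nat.choose_le_pow_div (k - 1) (n + (k - 1))).trans (by gcongr; omega)
  have := mul_le_mul_of_nonneg_right h (pow_nonneg hx (n + k))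
  simp only [polylogTerm, show 1 ≤ n + k by omega, if_true]
  calc _ = _ := by ring
    _ ≤ _ := this

theorem summable_polylogTerm (k : ℕ) {x : ℝ} (h0 : 0 ≤ x) (h1 : x < 1) :
    Summable (polylogTerm k x) := by
  rw [← summable_nat_add_iff 1]
  exact .of_nonneg_of_le (fun n => polylogTerm_nonneg k h0 _) (polylogTerm_succ_le k h0)
    ((summable_choose_mul_geometric_of_norm_lt_one (k - 1)
      (by rwa [Real.norm_of_nonneg h0])).mul_left x)

theorem tsum_polylogTerm_le {k : ℕ} (hk : 1 ≤ k) {x : ℝ} (h0 : 0 ≤ x) (h1 : x < 1) :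
    ∑' n, polylogTerm k x n ≤ x / (1 - x) ^ k := by
  have hx : ‖x‖ < 1 := by rwa [Real.norm_of_nonneg h0]
  have hs := summable_polylogTerm k h0 h1
  have h := Summable.tsum_le_tsum (polylogTerm_succ_le k h0) ((summable_nat_add_iff 1).2 hs)
    ((summable_choose_mul_geometric_of_norm_lt_one (k - 1) hx).mul_left x)
  rw [tsum_mul_left, tsum_choose_mul_geometric_of_norm_lt_one _ hx, Nat.sub_add_cancel hk] at h
  rw [hs.tsum_eq_zero_add]
  simpa [polylogTerm, div_eq_mul_inv] using h

theorem le_tsum_polylogTerm {k : ℕ} (hk : 1 ≤ k) {x : ℝ} (h0 : 0 ≤ x) (h1 : x < 1) :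
    x ^ k / (1 - x) ^ k ≤ ∑' n, polylogTerm k x n := by
  have hx : ‖x‖ < 1 := by rwa [Real.norm_of_nonneg h0]
  have hs := summable_polylogTerm k h0 h1
  have h := Summable.tsum_le_tsum (le_polylogTerm_add hk h0)
    ((summable_choose_mul_geometric_of_norm_lt_one (k - 1) hx).mul_left _)
    ((summable_nat_add_iff k).2 hs)
  rw [tsum_mul_left, tsum_choose_mul_geometric_of_norm_lt_one _ hx, Nat.sub_add_cancel hk] at h
  calc _ = _ := by ring
    _ ≤ _ := h
    _ ≤ _ := tsum_comp_le_tsum_of_inj hs (polylogTerm_nonneg k h0) (add_left_injective k)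

/-- `(1-q)^k ∑_{n ≥ 1} n^{k-1}/(k-1)! q^{mn}`, the modified `q`-analogue of `1/m^k`. -/
noncomputable def qInvPow (k m : ℕ) (q : ℝ) : ℝ :=
  (1 - q) ^ k * ∑' n, polylogTerm k (q ^ m) n

theorem qInvPow_nonneg (k m : ℕ) {q : ℝ} (h0 : 0 ≤ q) (h1 : q ≤ 1) : 0 ≤ qInvPow k m q :=
  mul_nonneg (pow_nonneg (sub_nonneg.2 h1) k)
    (tsum_nonneg (polylogTerm_nonneg k (pow_nonneg h0 m)))

theorem one_sub_pow_mul_div {k m : ℕ} {q : ℝ} (h1 : q < 1) (y : ℝ) :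
    (1 - q) ^ k * (y / (1 - q ^ m) ^ k) = y / (∑ i ∈ range m, q ^ i) ^ k := by
  rw [← mul_neg_geom_sum q m, mul_pow]
  have : (1 - q) ^ k ≠ 0 := pow_ne_zero _ (sub_ne_zero.2 h1.ne')
  field_simp

theorem qInvPow_le {k m : ℕ} (hk : 1 ≤ k) (hm : 1 ≤ m) {q : ℝ} (h0 : 0 ≤ q) (h1 : q < 1) :
    qInvPow k m q ≤ q ^ m / (∑ i ∈ range m, q ^ i) ^ k := by
  rw [← one_sub_pow_mul_div h1]
  exact mul_le_mul_of_nonneg_left (tsum_polylogTerm_le hk (pow_nonneg h0 m)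
    (pow_lt_one₀ h0 h1 (by omega))) (pow_nonneg (sub_nonneg.2 h1.le) k)

theorem le_qInvPow {k m : ℕ} (hk : 1 ≤ k) (hm : 1 ≤ m) {q : ℝ} (h0 : 0 ≤ q) (h1 : q < 1) :
    (q ^ m) ^ k / (∑ i ∈ range m, q ^ i) ^ k ≤ qInvPow k m q := by
  rw [← one_sub_pow_mul_div h1]
  exact mul_le_mul_of_nonneg_left (le_tsum_polylogTerm hk (pow_nonneg h0 m)
    (pow_lt_one₀ h0 h1 (by omega))) (pow_nonneg (sub_nonneg.2 h1.le) k)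

theorem qInvPow_le_inv {k m : ℕ} (hk : 1 ≤ k) (hm : 1 ≤ m) {q : ℝ} (h0 : 0 ≤ q) (h1 : q < 1) :
    qInvPow k m q ≤ (m : ℝ)⁻¹ := by
  have hS := one_le_geom_sum h0 hm
  refine (qInvPow_le hk hm h0 h1).trans ?_
  rw [inv_eq_one_div, div_le_div_iff₀ (by positivity) (by positivity)]
  linarith [card_mul_pow_le_geom_sum h0 h1.le m, le_self_pow₀ hS (by omega : k ≠ 0)]

theorem qInvPow_le_inv_sq {k m : ℕ} (hk : 2 ≤ k) (hm : 1 ≤ m) {q : ℝ} (h0 : 0 ≤ q)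
    (h1 : q < 1) : qInvPow k m q ≤ ((m : ℝ) ^ 2)⁻¹ := by
  have hS := one_le_geom_sum h0 hm
  refine (qInvPow_le (by omega) hm h0 h1).trans ?_
  rw [inv_eq_one_div, div_le_div_iff₀ (by positivity) (by positivity)]
  linarith [sq_mul_pow_le_sq_geom_sum h0 h1.le m, pow_le_pow_right₀ hS hk]

theorem tendsto_qInvPow {k m : ℕ} (hk : 1 ≤ k) (hm : 1 ≤ m) :
    Tendsto (qInvPow k m) (𝓝[Set.Ioo 0 1] 1) (𝓝 ((m : ℝ) ^ k)⁻¹) := by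
  have hne : (∑ i ∈ range m, (1 : ℝ) ^ i) ^ k ≠ 0 := by
    simp; omega
  have hlim (j : ℕ) : Tendsto (fun q : ℝ => (q ^ m) ^ j / (∑ i ∈ range m, q ^ i) ^ k)
      (𝓝[Set.Ioo 0 1] 1) (𝓝 ((m : ℝ) ^ k)⁻¹) := by
    have hc : ContinuousAt (fun q : ℝ => (q ^ m) ^ j / (∑ i ∈ range m, q ^ i) ^ k) 1 :=
      ContinuousAt.div (by fun_prop) (by fun_prop) hne
    simpa using hc.tendsto.mono_left nhdsWithin_le_nhds
  refine tendsto_of_tendsto_of_tendsto_of_le_of_le' (hlim k) (hlim 1) ?_ ?_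
  · filter_upwards [self_mem_nhdsWithin] with q hq using le_qInvPow hk hm hq.1.le hq.2
  · filter_upwards [self_mem_nhdsWithin] with q hq
    simpa using qInvPow_le hk hm hq.1.le hq.2

theorem prod_le_prod_inv_rpow {r : ℕ} (i₀ : Fin r) {a : Fin r → ℝ} {m : Fin r → ℕ}
    (hm : ∀ i, 1 ≤ m i) (hmax : ∀ i, m i ≤ m i₀) (ha : ∀ i, 0 ≤ a i)
    (hle : ∀ i, a i ≤ (m i : ℝ)⁻¹) (hle₀ : a i₀ ≤ ((m i₀ : ℝ) ^ 2)⁻¹) :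
    ∏ i, a i ≤ ∏ i, ((m i : ℝ) ^ (1 + (r : ℝ)⁻¹))⁻¹ := by
  have hr : (r : ℝ) ≠ 0 := by have := i₀.pos; positivity
  have hpos (i) : (0 : ℝ) < m i := by exact_mod_cast hm i
  calc ∏ i, a i ≤ (m i₀ : ℝ)⁻¹ * ∏ i, (m i : ℝ)⁻¹ := by
        rw [← mul_prod_erase _ _ (mem_univ i₀), ← mul_prod_erase univ (fun i => (m i : ℝ)⁻¹)
          (mem_univ i₀), ← mul_assoc, ← mul_inv, ← sq]
        exact mul_le_mul hle₀ (prod_le_prod (fun i _ => ha i) fun i _ => hle i)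
          (prod_nonneg fun i _ => ha i) (by positivity)
    _ = (∏ _i : Fin r, ((m i₀ : ℝ) ^ (r : ℝ)⁻¹)⁻¹) * ∏ i, (m i : ℝ)⁻¹ := by
        rw [prod_const, card_univ, Fintype.card_fin, inv_pow, ← Real.rpow_natCast,
          ← Real.rpow_mul (hpos i₀).le, inv_mul_cancel₀ hr, Real.rpow_one]
    _ ≤ _ := by
        rw [← prod_mul_distrib]
        refine prod_le_prod (fun i _ => by positivity) fun i _ => ?_
        rw [Real.rpow_add (hpos i), Real.rpow_one, mul_inv, mul_comm]
        have := hpos i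
        gcongr
        exact hmax i

theorem summable_prod_inv_rpow {r : ℕ} (hr : 0 < r) :
    Summable fun m : Fin r → ℕ => ∏ i, ((m i : ℝ) ^ (1 + (r : ℝ)⁻¹))⁻¹ :=
  (hasSum_pi_prod_of_nonneg (fun _ _ => by positivity) fun _ =>
    (Real.summable_nat_rpow_inv.2 (lt_add_of_pos_right 1 (by positivity))).hasSum).summable

/-- The summand of the modified `q`-analogue `(1-q)^{k₁+⋯+k_r} g_q(k₁,…,k_r)` after summation
over the `nᵢ`. -/
noncomputable def qmzvTerm {r : ℕ} (k : Fin r → ℕ) (q : ℝ) (m : Fin r → ℕ) : ℝ :=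
  if (∀ i j : Fin r, i < j → m j < m i) ∧ (∀ i, 1 ≤ m i) then ∏ i, qInvPow (k i) (m i) q else 0

theorem qmzvTerm_nonneg {r : ℕ} (k : Fin r → ℕ) {q : ℝ} (h0 : 0 ≤ q) (h1 : q ≤ 1)
    (m : Fin r → ℕ) : 0 ≤ qmzvTerm k q m := by
  unfold qmzvTerm
  split_ifs
  · exact prod_nonneg fun i _ => qInvPow_nonneg _ _ h0 h1
  · rfl

theorem qmzvTerm_le {r : ℕ} (hr : 0 < r) {k : Fin r → ℕ} (hk1 : 2 ≤ k ⟨0, hr⟩)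
    (hk : ∀ i, 1 ≤ k i) {q : ℝ} (h0 : 0 ≤ q) (h1 : q < 1) (m : Fin r → ℕ) :
    qmzvTerm k q m ≤ ∏ i, ((m i : ℝ) ^ (1 + (r : ℝ)⁻¹))⁻¹ := by
  unfold qmzvTerm
  split_ifs with h
  · refine prod_le_prod_inv_rpow ⟨0, hr⟩ h.2 (fun i => ?_)
      (fun i => qInvPow_nonneg _ _ h0 h1.le) (fun i => qInvPow_le_inv (hk i) (h.2 i) h0 h1)
      (qInvPow_le_inv_sq hk1 (h.2 _) h0 h1)
    rcases eq_or_ne i ⟨0, hr⟩ with rfl | hi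
    · rfl
    · exact (h.1 _ _ (Nat.pos_of_ne_zero fun h => hi (Fin.ext h))).le
  · exact prod_nonneg fun i _ => by positivity

theorem one_sub_pow_mul_gq {r : ℕ} (hr : 0 < r) {k : Fin r → ℕ} (hk1 : 2 ≤ k ⟨0, hr⟩)
    (hk : ∀ i, 1 ≤ k i) {q : ℝ} (h0 : 0 ≤ q) (h1 : q < 1) :
    (1 - q) ^ (∑ i, k i) * gq q r k = ∑' m, qmzvTerm k q m := by
  have hc : (1 - q) ^ (∑ i, k i) ≠ 0 := pow_ne_zero _ (sub_ne_zero.2 h1.ne')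
  have hT : Summable (qmzvTerm k q) := .of_nonneg_of_le (qmzvTerm_nonneg k h0 h1.le)
    (qmzvTerm_le hr hk1 hk h0 h1) (summable_prod_inv_rpow hr)
  unfold gq
  set F : (Fin r → ℕ) × (Fin r → ℕ) → ℝ := fun p =>
    if (∀ i j : Fin r, i < j → p.1 j < p.1 i) ∧ (∀ i, 1 ≤ p.1 i) ∧ (∀ i, 1 ≤ p.2 i) then
      (∏ i, (p.2 i : ℝ) ^ (k i - 1) / (Nat.factorial (k i - 1))) * q ^ (∑ i, p.1 i * p.2 i)
    else 0 with hF
  have hF0 : 0 ≤ F := by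
    intro p
    simp only [hF, Pi.zero_apply]
    split_ifs <;> positivity
  have hfiber (m : Fin r → ℕ) :
      HasSum (fun n => F (m, n)) (((1 - q) ^ (∑ i, k i))⁻¹ * qmzvTerm k q m) := by
    by_cases hm : (∀ i j : Fin r, i < j → m j < m i) ∧ (∀ i, 1 ≤ m i)
    · have h := hasSum_pi_prod_of_nonneg
        (fun i n => polylogTerm_nonneg (k i) (pow_nonneg h0 (m i)) n) fun i =>
        (summable_polylogTerm (k i) (pow_nonneg h0 (m i))
          (pow_lt_one₀ h0 h1 (Nat.one_le_iff_ne_zero.1 (hm.2 i)))).hasSum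
      rw [qmzvTerm, if_pos hm]
      simp only [qInvPow]
      rw [prod_mul_distrib, prod_pow_eq_pow_sum, inv_mul_cancel_left₀ hc]
      convert! h using 1
      ext n
      by_cases hn : ∀ i, 1 ≤ n i
      · rw [hF]
        dsimp only
        rw [if_pos ⟨hm.1, hm.2, hn⟩]
        simp [hn, polylogTerm, prod_mul_distrib, ← pow_mul, prod_pow_eq_pow_sum]
      · obtain ⟨i, hi⟩ := not_forall.1 hn
        rw [prod_eq_zero (mem_univ i) (by simp only [polylogTerm, if_neg hi])]
        exact if_neg fun H => hn H.2.2
    · have (n : Fin r → ℕ) : F (m, n) = 0 := if_neg fun H => hm ⟨H.1, H.2.1⟩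
      simp [this, qmzvTerm, if_neg hm, hasSum_zero]
  have hFs : Summable F := by
    rw [summable_prod_of_nonneg hF0]
    refine ⟨fun m => (hfiber m).summable, ?_⟩
    simp only [fun m => (hfiber m).tsum_eq]
    exact hT.mul_left _
  rw [hFs.tsum_prod]
  simp only [fun m => (hfiber m).tsum_eq]
  rw [tsum_mul_left, mul_inv_cancel_left₀ hc]

/-- `g(k₁,…,k_r)` is a modified `q`-analogue of weight `k₁+⋯+k_r` of
`ζ(k₁,…,k_r)`: as `q → 1⁻` (with `0 < q < 1`), `(1-q)^{k₁+⋯+k_r}·g_q(k₁,…,k_r)` tends to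
`ζ(k₁,…,k_r)`. -/
theorem stmt_1 (r : ℕ) (hr : 0 < r) (k : Fin r → ℕ) (hk1 : 2 ≤ k ⟨0, hr⟩)
    (hk : ∀ i, 1 ≤ k i) :
    Filter.Tendsto (fun q : ℝ => (1 - q) ^ (∑ i, k i) * gq q r k)
      (nhdsWithin 1 (Set.Ioo 0 1)) (nhds (mzv r k)) := by
  have h := tendsto_tsum_of_dominated_convergence (𝓕 := 𝓝[Set.Ioo 0 1] (1 : ℝ))
    (f := fun q m => qmzvTerm k q m) (summable_prod_inv_rpow hr) (g := fun m : Fin r → ℕ =>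
      if (∀ i j : Fin r, i < j → m j < m i) ∧ (∀ i, 1 ≤ m i) then
        ∏ i, ((m i : ℝ) ^ k i)⁻¹ else 0) ?_ ?_
  · refine h.congr' ?_
    filter_upwards [self_mem_nhdsWithin] with q hq
    exact (one_sub_pow_mul_gq hr hk1 hk hq.1.le hq.2).symm
  · intro m
    simp only [qmzvTerm]
    split_ifs with hm
    · exact tendsto_finsetProd _ fun i _ => tendsto_qInvPow (hk i) (hm.2 i)
    · exact tendsto_const_nhds
  · filter_upwards [self_mem_nhdsWithin] with q hq m
    rw [Real.norm_of_nonneg (qmzvTerm_nonneg k hq.1.le hq.2.le m)]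
    exact qmzvTerm_le hr hk1 hk hq.1.le hq.2 m
end

section
/- For all integers k_1, k_2 ≥ 1 and every integer n ≥ 1, one has Σ_{a=1}^{n−1} a^{k_1−1}(n−a)^{k_2−1}/((k_1−1)!(k_2−1)!) = n^{k_1+k_2−1}/(k_1+k_2−1)! + Σ_{j=1}^{k_1+k_2−1} λ^j_{k_1,k_2} · n^{j−1}/(j−1)!. (This is the coefficient-wise form of the identity P_{k_1}(x)/(1−x)^{k_1} · P_{k_2}(x)/(1−x)^{k_2} = P_{k_1+k_2}(x)/(1−x)^{k_1+k_2} + Σ_j λ^j_{k_1,k_2} P_j(x)/(1−x)^j used in the proof of the stuffle product.) -/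
/-- The rational numbers `λ^j_{k₁,k₂}`; the binomial coefficient `C(a,b)` is interpreted as `0`
when `b < 0` (i.e. when `j > k₂` resp. `j > k₁`), and `bernoulli` is the Bernoulli number
with the convention `B₁ = -1/2`. -/
noncomputable def lam (k1 k2 j : ℕ) : ℚ :=
  ((-1 : ℚ) ^ (k1 - 1) * (if j ≤ k2 then (Nat.choose (k1 + k2 - 1 - j) (k2 - j) : ℚ) else 0) +
      (-1 : ℚ) ^ (k2 - 1) * (if j ≤ k1 then (Nat.choose (k1 + k2 - 1 - j) (k1 - j) : ℚ) else 0)) *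
    bernoulli (k1 + k2 - j) / (Nat.factorial (k1 + k2 - j))


open Finset in
/-- Pascal recursion for alternating binomial sums, i.e. iterated backward differences. -/
theorem sum_alternating_choose_succ (g : ℕ → ℚ) (p q : ℕ) :
    ∑ i ∈ range (q + 2), (-1 : ℚ) ^ i * (q + 1).choose i * g (p + i) =
      ∑ i ∈ range (q + 1), (-1 : ℚ) ^ i * q.choose i * g (p + i) -
        ∑ i ∈ range (q + 1), (-1 : ℚ) ^ i * q.choose i * g (p + 1 + i) := by
  have h : ∑ i ∈ range (q + 1), (-1 : ℚ) ^ i * q.choose i * g (p + i) =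
      ∑ i ∈ range (q + 2), (-1 : ℚ) ^ i * q.choose i * g (p + i) := by
    rw [sum_range_succ _ (q + 1)]; simp
  rw [h, sum_range_succ', sum_range_succ' _ (q + 1), add_sub_right_comm, ← sum_sub_distrib]
  simp only [Nat.choose_zero_right]
  congr 1
  refine sum_congr rfl fun i _ => ?_
  rw [Nat.choose_succ_succ, show p + 1 + i = p + (i + 1) by ring]
  push_cast
  ring

open Finset in
theorem sum_alternating_choose_mul_choose (p q r : ℕ) :
    ∑ i ∈ range (q + 1), (-1 : ℚ) ^ i * q.choose i * (p + i).choose r =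
      (-1) ^ q * if q ≤ r then (p.choose (r - q) : ℚ) else 0 := by
  induction q generalizing p with
  | zero => simp
  | succ q ih =>
    rw [sum_alternating_choose_succ (fun m => (m.choose r : ℚ)), ih, ih]
    rcases lt_trichotomy r q with h | rfl | h
    · rw [if_neg (by lia), if_neg (by lia), if_neg (by lia)]; simp
    · simp
    · rw [if_pos h.le, if_pos h.le, if_pos (Nat.succ_le_of_lt h)]
      obtain ⟨t, rfl⟩ := Nat.exists_eq_add_of_lt h
      rw [show q + t + 1 - q = t + 1 by lia, show q + t + 1 - (q + 1) = t by lia,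
        Nat.choose_succ_succ]
      push_cast
      ring

open Finset Nat in
theorem sum_alternating_choose_div (p q : ℕ) :
    ∑ i ∈ range (q + 1), (-1 : ℚ) ^ i * q.choose i * ((p + i : ℕ) + 1 : ℚ)⁻¹ =
      (p ! * q ! : ℚ) / (p + q + 1)! := by
  induction q generalizing p with
  | zero =>
    have := Nat.factorial_ne_zero p
    simp [Nat.factorial_succ]
    field_simp
  | succ q ih =>
    rw [sum_alternating_choose_succ (fun m => ((m : ℚ) + 1)⁻¹), ih, ih,
      show p + 1 + q + 1 = p + q + 1 + 1 by ring, show p + (q + 1) + 1 = p + q + 1 + 1 by ring,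
      Nat.factorial_succ (p + q + 1), Nat.factorial_succ p, Nat.factorial_succ q]
    have := Nat.factorial_ne_zero (p + q + 1)
    push_cast
    field_simp
    ring

open Finset in
/-- Faulhaber's formula, with the range of summation extended to any `M > d + 1`. -/
theorem sum_range_pow_eq_sub (n d M : ℕ) (hM : d + 1 < M) :
    ∑ a ∈ range n, (a : ℚ) ^ d =
      ∑ m ∈ range M, bernoulli m * (d + 1).choose m * (n : ℚ) ^ (d + 1 - m) * ((d : ℚ) + 1)⁻¹ -
        bernoulli (d + 1) * ((d : ℚ) + 1)⁻¹ := by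
  have h : ∑ m ∈ range M,
        bernoulli m * (d + 1).choose m * (n : ℚ) ^ (d + 1 - m) * ((d : ℚ) + 1)⁻¹ =
      ∑ m ∈ range (d + 2),
        bernoulli m * (d + 1).choose m * (n : ℚ) ^ (d + 1 - m) * ((d : ℚ) + 1)⁻¹ := by
    symm
    refine sum_subset (range_mono hM) fun m _ hm => ?_
    rw [Nat.choose_eq_zero_of_lt (by simp at hm; lia)]
    simp
  rw [h, sum_range_succ, sum_range_pow]
  simp [div_eq_mul_inv]

open Finset Nat in
/-- Euler-Maclaurin summation for `x ^ p * (n - x) ^ q` on `[0, n]`. -/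
theorem sum_range_pow_mul_sub_pow (p q n : ℕ) :
    ∑ a ∈ range n, (a : ℚ) ^ p * ((n : ℚ) - a) ^ q =
      (p ! * q ! : ℚ) / (p + q + 1)! * (n : ℚ) ^ (p + q + 1) +
      ∑ r ∈ range (p + q + 1), bernoulli (r + 1) * ((r : ℚ) + 1)⁻¹ * (n : ℚ) ^ (p + q - r) *
        ((-1) ^ q * if q ≤ r then (p.choose (r - q) : ℚ) else 0) -
      ∑ i ∈ range (q + 1), (-1 : ℚ) ^ i * q.choose i * (n : ℚ) ^ (q - i) *
        (bernoulli (p + i + 1) * ((p + i : ℕ) + 1 : ℚ)⁻¹) := by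
  have h1 : ∑ a ∈ range n, (a : ℚ) ^ p * ((n : ℚ) - a) ^ q =
      ∑ i ∈ range (q + 1), (-1 : ℚ) ^ i * q.choose i * (n : ℚ) ^ (q - i) *
        ∑ a ∈ range n, (a : ℚ) ^ (p + i) := by
    simp_rw [mul_sum]
    rw [sum_comm]
    refine sum_congr rfl fun a _ => ?_
    rw [sub_eq_neg_add, add_pow, mul_sum]
    refine sum_congr rfl fun i _ => ?_
    rw [neg_pow, pow_add]
    ring
  have h2 : ∑ i ∈ range (q + 1), (-1 : ℚ) ^ i * q.choose i * (n : ℚ) ^ (q - i) *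
        ∑ a ∈ range n, (a : ℚ) ^ (p + i) =
      ∑ m ∈ range (p + q + 2), bernoulli m * (n : ℚ) ^ (p + q + 1 - m) *
        ∑ i ∈ range (q + 1), (-1 : ℚ) ^ i * q.choose i *
          ((p + i + 1).choose m * ((p + i : ℕ) + 1 : ℚ)⁻¹) -
      ∑ i ∈ range (q + 1), (-1 : ℚ) ^ i * q.choose i * (n : ℚ) ^ (q - i) *
        (bernoulli (p + i + 1) * ((p + i : ℕ) + 1 : ℚ)⁻¹) := by
    simp_rw [mul_sum _ _ (bernoulli _ * _)]
    rw [sum_comm, ← sum_sub_distrib]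
    refine sum_congr rfl fun i hi => ?_
    have hi := mem_range.1 hi
    rw [sum_range_pow_eq_sub n (p + i) (p + q + 2) (by lia), mul_sub, mul_sum]
    congr 1
    refine sum_congr rfl fun m _ => ?_
    rcases le_or_gt m (p + i + 1) with hm | hm
    · rw [show p + q + 1 - m = (q - i) + (p + i + 1 - m) by lia, pow_add]
      ring
    · rw [Nat.choose_eq_zero_of_lt hm]
      simp
  rw [h1, h2, sum_range_succ']
  congr 1
  rw [add_comm]
  congr 1
  · simp only [Nat.choose_zero_right, bernoulli_zero, Nat.cast_one, one_mul, Nat.sub_zero]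
    rw [sum_alternating_choose_div, mul_comm]
  · refine sum_congr rfl fun r _ => ?_
    rw [← sum_alternating_choose_mul_choose, mul_sum, mul_sum,
      show p + q + 1 - (r + 1) = p + q - r by lia]
    refine sum_congr rfl fun i _ => ?_
    have h : (((p + i : ℕ) + 1 : ℚ)) * (p + i).choose r = (p + i + 1).choose (r + 1) * (r + 1) := by
      exact_mod_cast Nat.add_one_mul_choose_eq (p + i) r
    have h' : ((p + i + 1).choose (r + 1) : ℚ) * ((p + i : ℕ) + 1 : ℚ)⁻¹ =
        ((r : ℚ) + 1)⁻¹ * (p + i).choose r := by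
      have : ((p + i : ℕ) + 1 : ℚ) ≠ 0 := by positivity
      field_simp
      linarith
    rw [h']
    ring

open Nat in
theorem choose_div_factorial_mul_factorial (p q r : ℕ) (hr : r ≤ p + q) :
    (if p ≤ r then (r.choose (r - p) : ℚ) else 0) / ((r + 1)! * (p + q - r)!) =
      (if p ≤ r then (q.choose (r - p) : ℚ) else 0) * ((r : ℚ) + 1)⁻¹ / (p ! * q !) := by
  split_ifs with h
  · obtain ⟨i, rfl⟩ := Nat.exists_eq_add_of_le h
    obtain ⟨t, rfl⟩ := Nat.exists_eq_add_of_le (show i ≤ q by lia)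
    rw [show p + (i + t) - (p + i) = t by lia, Nat.add_sub_cancel_left, Nat.cast_add_choose,
      ← Nat.choose_symm_add, Nat.cast_add_choose, Nat.factorial_succ]
    have := Nat.factorial_ne_zero (p + i)
    have := Nat.factorial_ne_zero (i + t)
    have := Nat.factorial_ne_zero p
    have := Nat.factorial_ne_zero i
    have := Nat.factorial_ne_zero t
    push_cast
    field_simp
  · simp

open Nat in
theorem lam_mul_pow_div_factorial (p q r n : ℕ) (hr : r ≤ p + q) :
    lam (p + 1) (q + 1) (p + q - r + 1) * (n : ℚ) ^ (p + q - r) / (p + q - r)! =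
      bernoulli (r + 1) * ((r : ℚ) + 1)⁻¹ * (n : ℚ) ^ (p + q - r) *
        ((-1) ^ p * (if p ≤ r then (q.choose (r - p) : ℚ) else 0) +
          (-1) ^ q * if q ≤ r then (p.choose (r - q) : ℚ) else 0) / (p ! * q !) := by
  have h1 := choose_div_factorial_mul_factorial p q r hr
  have h2 := choose_div_factorial_mul_factorial q p r (by lia)
  rw [add_comm q p, mul_comm (q ! : ℚ)] at h2
  have e1 : p + 1 + (q + 1) - 1 - (p + q - r + 1) = r := by lia
  have e2 : p + 1 + (q + 1) - (p + q - r + 1) = r + 1 := by lia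
  have c1 : (p + q - r + 1 ≤ q + 1) = (p ≤ r) := by apply propext; lia
  have c2 : (p + q - r + 1 ≤ p + 1) = (q ≤ r) := by apply propext; lia
  have d1 : p ≤ r → q + 1 - (p + q - r + 1) = r - p := by lia
  have d2 : q ≤ r → p + 1 - (p + q - r + 1) = r - q := by lia
  have i1 : (if p ≤ r then (r.choose (q + 1 - (p + q - r + 1)) : ℚ) else 0) =
      if p ≤ r then (r.choose (r - p) : ℚ) else 0 := by
    split_ifs with h
    · rw [d1 h]
    · rfl
  have i2 : (if q ≤ r then (r.choose (p + 1 - (p + q - r + 1)) : ℚ) else 0) =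
      if q ≤ r then (r.choose (r - q) : ℚ) else 0 := by
    split_ifs with h
    · rw [d2 h]
    · rfl
  simp only [lam, e1, e2, c1, c2, i1, i2, Nat.add_sub_cancel]
  linear_combination (bernoulli (r + 1) * (n : ℚ) ^ (p + q - r)) *
    ((-1) ^ p * h1 + (-1) ^ q * h2)

open Finset in
/-- The boundary terms at `0`; the summand `a = 0` accounts for the sign of `B₁`. -/
theorem boundary_terms_at_zero (p q n : ℕ) :
    ∑ r ∈ range (p + q + 1), bernoulli (r + 1) * ((r : ℚ) + 1)⁻¹ * (n : ℚ) ^ (p + q - r) *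
        ((-1) ^ p * if p ≤ r then (q.choose (r - p) : ℚ) else 0) =
      -(0 : ℚ) ^ p * (n : ℚ) ^ q - ∑ i ∈ range (q + 1), (-1 : ℚ) ^ i * q.choose i *
        (n : ℚ) ^ (q - i) * (bernoulli (p + i + 1) * ((p + i : ℕ) + 1 : ℚ)⁻¹) := by
  have h0 : ∑ r ∈ range p, bernoulli (r + 1) * ((r : ℚ) + 1)⁻¹ * (n : ℚ) ^ (p + q - r) *
        ((-1) ^ p * if p ≤ r then (q.choose (r - p) : ℚ) else 0) = 0 :=
    sum_eq_zero fun r hr => by rw [if_neg (by simpa using hr)]; simp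
  rw [add_assoc, sum_range_add, h0, zero_add, sum_range_succ', sum_range_succ' _ q]
  have h1 : ∀ i, (-1 : ℚ) ^ p * bernoulli (p + (i + 1) + 1) =
      -((-1) ^ (i + 1) * bernoulli (p + (i + 1) + 1)) := by
    intro i
    have hB := bernoulli'_eq_bernoulli (p + (i + 1) + 1)
    rw [← bernoulli_eq_bernoulli'_of_ne_one (by lia)] at hB
    have hsq : (-1 : ℚ) ^ (i + 1) * (-1) ^ (i + 1) = 1 := by rw [← mul_pow]; simp
    rw [pow_succ, pow_add] at hB
    linear_combination (-1 : ℚ) ^ (i + 1) * hB - (-1 : ℚ) ^ p * bernoulli (p + (i + 1) + 1) * hsq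
  have h2 : (-1 : ℚ) ^ p * bernoulli (p + 1) * ((p : ℚ) + 1)⁻¹ =
      -0 ^ p - bernoulli (p + 1) * ((p : ℚ) + 1)⁻¹ := by
    rcases Nat.eq_zero_or_pos p with rfl | hp
    · norm_num [bernoulli_one]
    · have hB := bernoulli'_eq_bernoulli (p + 1)
      rw [← bernoulli_eq_bernoulli'_of_ne_one (by lia)] at hB
      rw [zero_pow hp.ne']
      rw [pow_succ] at hB
      linear_combination ((p : ℚ) + 1)⁻¹ * hB
  rw [← sub_sub, sub_right_comm, sub_eq_add_neg _ (∑ i ∈ range q, _), ← sum_neg_distrib,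
    add_comm (_ - _)]
  congr 1
  · refine sum_congr rfl fun i _ => ?_
    rw [if_pos (by lia), Nat.add_sub_cancel_left, show p + q - (p + (i + 1)) = q - (i + 1) by lia]
    linear_combination (((p + (i + 1) : ℕ) + 1 : ℚ)⁻¹ * (n : ℚ) ^ (q - (i + 1)) *
      q.choose (i + 1)) * h1 i
  · simp only [add_zero, le_refl, if_true, Nat.sub_self, Nat.choose_zero_right, Nat.sub_zero,
      Nat.add_sub_cancel_left]
    push_cast
    linear_combination (n : ℚ) ^ q * h2

/-- coefficient-wise form of the Eulerian polynomial identity used in the proof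
of the stuffle product. -/
theorem stmt_2 (k1 k2 n : ℕ) (hk1 : 1 ≤ k1) (hk2 : 1 ≤ k2) (hn : 1 ≤ n) :
    ∑ a ∈ Finset.Ico 1 n,
        (a : ℚ) ^ (k1 - 1) * ((n - a : ℕ) : ℚ) ^ (k2 - 1) /
          ((Nat.factorial (k1 - 1)) * (Nat.factorial (k2 - 1))) =
      (n : ℚ) ^ (k1 + k2 - 1) / (Nat.factorial (k1 + k2 - 1)) +
        ∑ j ∈ Finset.Icc 1 (k1 + k2 - 1),
          lam k1 k2 j * (n : ℚ) ^ (j - 1) / (Nat.factorial (j - 1)) := by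
  obtain ⟨p, rfl⟩ := Nat.exists_eq_add_of_le' hk1
  obtain ⟨q, rfl⟩ := Nat.exists_eq_add_of_le' hk2
  have hR : ∑ j ∈ Finset.Icc 1 (p + 1 + (q + 1) - 1),
      lam (p + 1) (q + 1) j * (n : ℚ) ^ (j - 1) / (Nat.factorial (j - 1)) =
      (∑ r ∈ Finset.range (p + q + 1),
        bernoulli (r + 1) * ((r : ℚ) + 1)⁻¹ * (n : ℚ) ^ (p + q - r) *
          ((-1) ^ p * (if p ≤ r then (q.choose (r - p) : ℚ) else 0) +
            (-1) ^ q * if q ≤ r then (p.choose (r - q) : ℚ) else 0)) /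
        (p.factorial * q.factorial) := by
    rw [show p + 1 + (q + 1) - 1 = p + q + 1 by lia, Finset.sum_div,
      ← Finset.Ico_add_one_right_eq_Icc, Finset.sum_Ico_eq_sum_range, Nat.add_sub_cancel,
      ← Finset.sum_range_reflect]
    refine Finset.sum_congr rfl fun r hr => ?_
    have hr := Finset.mem_range.1 hr
    rw [← lam_mul_pow_div_factorial p q r n (by lia),
      show 1 + (p + q + 1 - 1 - r) = p + q - r + 1 by lia, Nat.add_sub_cancel]
  have hL : ∑ a ∈ Finset.Ico 1 n, (a : ℚ) ^ p * ((n - a : ℕ) : ℚ) ^ q =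
      ∑ a ∈ Finset.range n, (a : ℚ) ^ p * ((n : ℚ) - a) ^ q - 0 ^ p * (n : ℚ) ^ q := by
    rw [Finset.range_eq_Ico, Finset.sum_eq_sum_Ico_succ_bot hn]
    simp only [Nat.cast_zero, sub_zero, add_sub_cancel_left, zero_add]
    refine Finset.sum_congr rfl fun a ha => ?_
    rw [Nat.cast_sub (Finset.mem_Ico.1 ha).2.le]
  simp only [Nat.add_sub_cancel]
  rw [← Finset.sum_div, hL, hR, sum_range_pow_mul_sub_pow]
  simp only [mul_add, Finset.sum_add_distrib]
  rw [boundary_terms_at_zero, show p + 1 + (q + 1) - 1 = p + q + 1 by lia]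
  have := Nat.factorial_ne_zero p
  have := Nat.factorial_ne_zero q
  generalize ∑ r ∈ Finset.range (p + q + 1), (_ : ℚ) = S
  generalize ∑ i ∈ Finset.range (q + 1), (_ : ℚ) = T
  field_simp
  ring
end

section
/- For all integers k_1, k_2 ≥ 1, the following identity holds in ℚ[[q]]: g(k_1)·g(k_2) = g(k_1,k_2) + g(k_2,k_1) + g(k_1+k_2) + Σ_{j=1}^{k_1+k_2−1} λ^j_{k_1,k_2} · g(j). -/
/-- The `q`-series `g(k; d)` of depth one: the coefficient of `q^N` is
`∑_{m·n = N, m,n ≥ 1} m^d n^(k-1)/(k-1)!`. -/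
noncomputable def gone (k d : ℕ) : PowerSeries ℚ :=
  PowerSeries.mk fun N =>
    ∑ m ∈ Finset.range (N + 1), ∑ n ∈ Finset.range (N + 1),
      if 1 ≤ m ∧ 1 ≤ n ∧ m * n = N then
        (m : ℚ) ^ d * (n : ℚ) ^ (k - 1) / (Nat.factorial (k - 1)) else 0

/-- The `q`-series `g(k₁,k₂; d₁,d₂)` of depth two: the coefficient of `q^N` is the sum over
`m₁ > m₂ > 0`, `n₁, n₂ > 0` with `m₁n₁ + m₂n₂ = N` of
`m₁^d₁ n₁^(k₁-1)/(k₁-1)! · m₂^d₂ n₂^(k₂-1)/(k₂-1)!`. -/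
noncomputable def gtwo (k1 k2 d1 d2 : ℕ) : PowerSeries ℚ :=
  PowerSeries.mk fun N =>
    ∑ m1 ∈ Finset.range (N + 1), ∑ m2 ∈ Finset.range (N + 1),
      ∑ n1 ∈ Finset.range (N + 1), ∑ n2 ∈ Finset.range (N + 1),
        if m2 < m1 ∧ 1 ≤ m2 ∧ 1 ≤ n1 ∧ 1 ≤ n2 ∧ m1 * n1 + m2 * n2 = N then
          ((m1 : ℚ) ^ d1 * (n1 : ℚ) ^ (k1 - 1) / (Nat.factorial (k1 - 1))) *
            ((m2 : ℚ) ^ d2 * (n2 : ℚ) ^ (k2 - 1) / (Nat.factorial (k2 - 1)))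
        else 0

open Polynomial in
/-- The umbral functional `X ^ m ↦ B_m`. -/
noncomputable def bernoulliFunctional : ℚ[X] →ₗ[ℚ] ℚ :=
  Polynomial.lsum fun m => LinearMap.mulRight ℚ (_root_.bernoulli m)

open Polynomial in
theorem bernoulliFunctional_eq_sum_range (P : ℚ[X]) {D : ℕ} (hD : P.natDegree < D) :
    bernoulliFunctional P = ∑ m ∈ Finset.range D, P.coeff m * _root_.bernoulli m := by
  simpa [bernoulliFunctional] using
    P.sum_over_range' (f := fun m c => c * _root_.bernoulli m) (by simp) D hD

open Polynomial in
theorem bernoulliFunctional_taylor_one (P : ℚ[X]) :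
    bernoulliFunctional (taylor 1 P) = bernoulliFunctional P + (derivative P).eval 0 := by
  induction P using Polynomial.induction_on' with
  | add p q hp hq => simp only [map_add, hp, hq, eval_add]; ring
  | monomial k c =>
    have hsum := _root_.sum_bernoulli k
    rw [taylor_monomial, ← smul_eq_C_mul, map_smul,
      show monomial k c = c • monomial k (1 : ℚ) by rw [smul_monomial, smul_eq_mul, mul_one],
      map_smul, derivative_smul, eval_smul, ← smul_add]
    congr 1
    rw [bernoulliFunctional_eq_sum_range _ (D := k + 1)
        (by simp [natDegree_pow, -map_one]),
      bernoulliFunctional_eq_sum_range _ (D := k + 1)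
        (Nat.lt_succ_of_le (natDegree_monomial_le 1))]
    simp only [coeff_X_add_C_pow, one_pow, one_mul, coeff_monomial]
    rw [Finset.sum_range_succ, hsum, Finset.sum_range_succ, Finset.sum_eq_zero]
    · rcases k with _ | _ | k <;> norm_num
    · intro i hi
      rw [if_neg (by have := Finset.mem_range.mp hi; lia), zero_mul]

open Polynomial in
/-- Euler–Maclaurin summation for polynomials. -/
theorem sum_range_eval_derivative (P : ℚ[X]) (n : ℕ) :
    ∑ a ∈ Finset.range n, (derivative P).eval (a : ℚ) =
      bernoulliFunctional (taylor (n : ℚ) P) - bernoulliFunctional P := by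
  induction n with
  | zero => simp
  | succ n ih =>
    have h := bernoulliFunctional_taylor_one (taylor (n : ℚ) P)
    rw [taylor_taylor, ← coeff_zero_eq_eval_zero, coeff_derivative, taylor_coeff_one] at h
    rw [Finset.sum_range_succ, ih, Nat.cast_succ, add_comm (n : ℚ) 1, h]
    simp
    ring

open Polynomial in
theorem exists_antiderivative_beta (n : ℚ) (q : ℕ) : ∀ p : ℕ, ∃ F : ℚ[X],
    derivative F = C ((p.factorial * q.factorial : ℚ)⁻¹) * (X ^ p * (C n - X) ^ q) ∧
    F.natDegree < p + q + 2 ∧ F.eval 0 = 0 ∧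
    F.eval n = n ^ (p + q + 1) / (p + q + 1).factorial := by
  induction q with
  | zero =>
    intro p
    refine ⟨C (((p + 1).factorial : ℚ)⁻¹) * X ^ (p + 1), ?_, ?_, ?_, ?_⟩
    · rw [derivative_C_mul, derivative_X_pow, ← mul_assoc, ← C_mul, Nat.factorial_succ]
      simp only [pow_zero, mul_one, Nat.factorial_zero, Nat.cast_one, add_tsub_cancel_right]
      congr 2
      have : ((p.factorial : ℕ) : ℚ) ≠ 0 := by positivity
      push_cast
      field_simp
    · exact (natDegree_C_mul_X_pow_le _ _).trans_lt (by lia)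
    · simp
    · simp; ring
  | succ q ih =>
    intro p
    obtain ⟨F, hF, hdeg, h0, hn⟩ := ih (p + 1)
    refine ⟨F + C (((p + 1).factorial * (q + 1).factorial : ℚ)⁻¹) *
      (X ^ (p + 1) * (C n - X) ^ (q + 1)), ?_, ?_, ?_, ?_⟩
    · have hp : ((p.factorial : ℕ) : ℚ) ≠ 0 := by positivity
      have hq : ((q.factorial : ℕ) : ℚ) ≠ 0 := by positivity
      have e1 : (((p + 1).factorial * q.factorial : ℚ)⁻¹) =
          (((p + 1).factorial * (q + 1).factorial : ℚ)⁻¹) * ((q : ℚ) + 1) := by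
        rw [Nat.factorial_succ q]; push_cast; field_simp
      have e2 : ((p.factorial * (q + 1).factorial : ℚ)⁻¹) =
          (((p + 1).factorial * (q + 1).factorial : ℚ)⁻¹) * ((p : ℚ) + 1) := by
        rw [Nat.factorial_succ p]; push_cast; field_simp
      rw [derivative_add, hF, derivative_C_mul, derivative_mul, derivative_X_pow,
        derivative_pow, derivative_sub, derivative_C, derivative_X, e1, e2]
      simp only [C_mul, C_add, add_tsub_cancel_right, Nat.cast_add, Nat.cast_one, C_1]
      ring
    · refine (natDegree_add_le _ _).trans_lt (max_lt (by lia) ?_)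
      refine (natDegree_C_mul_le _ _).trans_lt (natDegree_mul_le.trans_lt ?_)
      have h1 : ((C n - X : ℚ[X]) ^ (q + 1)).natDegree ≤ (q + 1) * 1 :=
        natDegree_pow_le_of_le _ (by compute_degree)
      rw [natDegree_X_pow]
      lia
    · simp [h0]
    · simp only [eval_add, hn, eval_mul, eval_C, eval_pow, eval_X, eval_sub, sub_self]
      rw [show p + 1 + q + 1 = p + (q + 1) + 1 by ring]
      simp

open Polynomial in
theorem coeff_C_sub_X_pow (n : ℚ) (q k : ℕ) :
    ((C n - X) ^ q : ℚ[X]).coeff k = (-1) ^ k * (q.choose k : ℚ) * n ^ (q - k) := by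
  rw [show (C n - X : ℚ[X]) = C (-1) * (X + C (-n)) by simp; ring, mul_pow, ← C_pow, coeff_C_mul,
    coeff_X_add_C_pow]
  rcases le_or_gt k q with h | h
  · obtain ⟨r, rfl⟩ := Nat.exists_eq_add_of_le h
    rw [add_tsub_cancel_left, neg_pow n, pow_add]
    have : ((-1 : ℚ) ^ r) * (-1) ^ r = 1 := by rw [← mul_pow]; simp
    linear_combination (((k + r).choose k : ℚ) * n ^ r * (-1) ^ k) * this
  · simp [Nat.choose_eq_zero_of_lt h]

theorem bernoulli_succ_eq (m : ℕ) :
    bernoulli (m + 1) = (-1) ^ (m + 1) * bernoulli (m + 1) - if m = 0 then 1 else 0 := by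
  rw [← bernoulli'_eq_bernoulli]
  rcases eq_or_ne m 0 with rfl | h
  · norm_num
  · rw [bernoulli_eq_bernoulli'_of_ne_one (by lia), if_neg h, sub_zero]

theorem inv_factorial_mul_choose (p i r : ℕ) :
    (p.factorial * (i + r).factorial : ℚ)⁻¹ * ((i + r).choose i : ℚ) =
      ((p + i).choose p : ℚ) / (p + i).factorial / r.factorial := by
  have h1 : (i + r).choose i * i.factorial * r.factorial = (i + r).factorial := by
    simpa using Nat.choose_mul_factorial_mul_factorial (Nat.le_add_right i r)
  have h2 : (p + i).choose p * p.factorial * i.factorial = (p + i).factorial := by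
    simpa using Nat.choose_mul_factorial_mul_factorial (Nat.le_add_right p i)
  rw [← h1, ← h2]
  have a1 : (((i + r).choose i : ℕ) : ℚ) ≠ 0 := by
    exact_mod_cast (Nat.choose_pos (Nat.le_add_right i r)).ne'
  have a2 : (((p + i).choose p : ℕ) : ℚ) ≠ 0 := by
    exact_mod_cast (Nat.choose_pos (Nat.le_add_right p i)).ne'
  push_cast
  field_simp

open Polynomial in
theorem coeff_beta (n : ℚ) {p q m : ℕ} (hm : m < p + q + 1) :
    (C ((p.factorial * q.factorial : ℚ)⁻¹) * (X ^ p * (C n - X) ^ q)).coeff m =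
      (-1) ^ (m + p) * (if p ≤ m then (m.choose p : ℚ) else 0) / m.factorial *
        (n ^ (p + q - m) / (p + q - m).factorial) := by
  rw [coeff_C_mul, coeff_X_pow_mul']
  split_ifs with h
  · obtain ⟨i, rfl⟩ := Nat.exists_eq_add_of_le h
    obtain ⟨r, rfl⟩ := Nat.exists_eq_add_of_le (show i ≤ q by lia)
    rw [coeff_C_sub_X_pow, show p + i - p = i by lia, show i + r - i = r by lia,
      show p + (i + r) - (p + i) = r by lia,
      show (-1 : ℚ) ^ (p + i + p) = (-1) ^ i by
        rw [show p + i + p = i + 2 * p by ring, pow_add, pow_mul]; simp]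
    linear_combination ((-1) ^ i * n ^ r) * inv_factorial_mul_choose p i r
  · simp

open Polynomial in
theorem taylor_beta (n : ℚ) (p q : ℕ) :
    taylor n (C ((p.factorial * q.factorial : ℚ)⁻¹) * (X ^ p * (C n - X) ^ q)) =
      C ((-1) ^ (p + q)) * (C ((q.factorial * p.factorial : ℚ)⁻¹) *
        (X ^ q * (C (-n) - X) ^ p)) := by
  have h1 : (X + C n : ℚ[X]) = C (-1) * (C (-n) - X) := by simp
  have h2 : (C n - (X + C n) : ℚ[X]) = C (-1) * X := by simp
  simp only [taylor_mul, taylor_C, taylor_pow, taylor_X, map_sub, h2]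
  rw [h1, mul_comm (p.factorial : ℚ)]
  simp only [mul_pow, pow_add, C_mul, C_pow]
  ring

open Polynomial in
theorem sum_range_beta (p q n : ℕ) :
    ∑ a ∈ Finset.range n, (a : ℚ) ^ p * ((n : ℚ) - a) ^ q / (p.factorial * q.factorial) =
      (n : ℚ) ^ (p + q + 1) / (p + q + 1).factorial +
      (if p = 0 then (n : ℚ) ^ q / q.factorial else 0) +
      ∑ m ∈ Finset.range (p + q + 1), ((-1) ^ p * (if p ≤ m then (m.choose p : ℚ) else 0) +
          (-1) ^ q * (if q ≤ m then (m.choose q : ℚ) else 0)) * _root_.bernoulli (m + 1) /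
            (m + 1).factorial * ((n : ℚ) ^ (p + q - m) / (p + q - m).factorial) := by
  obtain ⟨F, hF, hdeg, h0, hn⟩ := exists_antiderivative_beta (n : ℚ) q p
  have hsum := sum_range_eval_derivative F n
  rw [bernoulliFunctional_eq_sum_range F hdeg,
    bernoulliFunctional_eq_sum_range _ (D := p + q + 2) (by rwa [natDegree_taylor]),
    Finset.sum_range_succ' _ (p + q + 1), Finset.sum_range_succ' _ (p + q + 1), taylor_coeff_zero, hn,
    coeff_zero_eq_eval_zero, h0] at hsum
  have hcoeff (P : ℚ[X]) (m : ℕ) :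
      P.coeff (m + 1) = (derivative P).coeff m / ((m : ℚ) + 1) := by
    rw [coeff_derivative]
    field_simp
  have htaylor : derivative (taylor (n : ℚ) F) = taylor (n : ℚ) (derivative F) := by
    simp [taylor_apply, derivative_comp]
  have hterm : ∀ m ∈ Finset.range (p + q + 1),
      (taylor (n : ℚ) F).coeff (m + 1) * _root_.bernoulli (m + 1) -
        F.coeff (m + 1) * _root_.bernoulli (m + 1) =
      ((-1) ^ p * (if p ≤ m then (m.choose p : ℚ) else 0) +
          (-1) ^ q * (if q ≤ m then (m.choose q : ℚ) else 0)) * _root_.bernoulli (m + 1) /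
            (m + 1).factorial * ((n : ℚ) ^ (p + q - m) / (p + q - m).factorial) +
      if m = 0 then F.coeff 1 else 0 := by
    intro m hm
    rw [Finset.mem_range] at hm
    have hT : (taylor (n : ℚ) F).coeff (m + 1) =
        (-1) ^ q * (if q ≤ m then (m.choose q : ℚ) else 0) / (m + 1).factorial *
          ((n : ℚ) ^ (p + q - m) / (p + q - m).factorial) := by
      have hsign : (-1 : ℚ) ^ (p + q) * (-1) ^ (m + q) * (-1) ^ (p + q - m) = (-1) ^ q := by
        rw [← pow_add, ← pow_add, show p + q + (m + q) + (p + q - m) = q + 2 * (p + q) by lia,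
          pow_add, pow_mul]
        simp
      rw [hcoeff, htaylor, hF, taylor_beta, coeff_C_mul, coeff_beta _ (by lia), add_comm q p,
        neg_pow (n : ℚ), Nat.factorial_succ, Nat.cast_mul, Nat.cast_succ,
        div_mul_eq_div_div_swap _ ((m : ℚ) + 1)]
      linear_combination ((if q ≤ m then (m.choose q : ℚ) else 0) / m.factorial / (m + 1) *
        (n : ℚ) ^ (p + q - m) / (p + q - m).factorial) * hsign
    have hF' : F.coeff (m + 1) =
        (-1) ^ (m + p) * (if p ≤ m then (m.choose p : ℚ) else 0) / (m + 1).factorial *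
          ((n : ℚ) ^ (p + q - m) / (p + q - m).factorial) := by
      rw [hcoeff, hF, coeff_beta _ (by lia), Nat.factorial_succ]
      push_cast
      field_simp
    have hB : F.coeff (m + 1) * _root_.bernoulli (m + 1) =
        F.coeff (m + 1) * ((-1) ^ (m + 1) * _root_.bernoulli (m + 1)) -
          if m = 0 then F.coeff 1 else 0 := by
      nth_rewrite 1 [bernoulli_succ_eq m]
      split_ifs with h
      · subst h; ring
      · ring
    have hsq : (-1 : ℚ) ^ m * (-1) ^ m = 1 := by rw [← mul_pow]; simp
    rw [hB, hT, hF']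
    linear_combination ((-1) ^ p * (if p ≤ m then (m.choose p : ℚ) else 0) *
      _root_.bernoulli (m + 1) / (m + 1).factorial *
        ((n : ℚ) ^ (p + q - m) / (p + q - m).factorial)) * hsq
  have heval (a : ℕ) : (derivative F).eval (a : ℚ) =
      (a : ℚ) ^ p * ((n : ℚ) - a) ^ q / (p.factorial * q.factorial) := by
    rw [hF]
    simp
    ring
  have hF1 : F.coeff 1 = if p = 0 then (n : ℚ) ^ q / q.factorial else 0 := by
    have := heval 0
    rw [Nat.cast_zero, ← coeff_zero_eq_eval_zero, coeff_derivative] at this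
    rcases eq_or_ne p 0 with rfl | hp
    · simpa using this
    · simpa [hp] using this
  simp only [heval] at hsum
  rw [hsum, ← hF1]
  have := Finset.sum_congr rfl hterm
  rw [Finset.sum_sub_distrib, Finset.sum_add_distrib, Finset.sum_ite_eq', if_pos (by simp)] at this
  simp only [_root_.bernoulli_zero]
  linear_combination this

/-- The convolution `∑_{a + b = n, a, b ≥ 1} a^(k₁-1)/(k₁-1)! · b^(k₂-1)/(k₂-1)!`. -/
theorem sum_convolution (k1 k2 n : ℕ) (h1 : 1 ≤ k1) (h2 : 1 ≤ k2) (hn : 1 ≤ n) :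
    ∑ a ∈ Finset.range n, (if 1 ≤ a then (a : ℚ) ^ (k1 - 1) / (k1 - 1).factorial *
        (((n - a : ℕ) : ℚ) ^ (k2 - 1) / (k2 - 1).factorial) else 0) =
      (n : ℚ) ^ (k1 + k2 - 1) / (k1 + k2 - 1).factorial +
        ∑ j ∈ Finset.Icc 1 (k1 + k2 - 1),
          lam k1 k2 j * ((n : ℚ) ^ (j - 1) / (j - 1).factorial) := by
  obtain ⟨p, rfl⟩ := Nat.exists_eq_add_of_le' h1
  obtain ⟨q, rfl⟩ := Nat.exists_eq_add_of_le' h2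
  have hbeta := sum_range_beta p q n
  have hzero : (if p = 0 then (n : ℚ) ^ q / q.factorial else 0) =
      ∑ a ∈ Finset.range n, if a = 0 then
        (a : ℚ) ^ p * ((n : ℚ) - a) ^ q / (p.factorial * q.factorial) else 0 := by
    rw [Finset.sum_ite_eq', if_pos (Finset.mem_range.mpr hn)]
    rcases eq_or_ne p 0 with rfl | hp <;> simp [*]
  have hlam : ∑ j ∈ Finset.Icc 1 (p + 1 + (q + 1) - 1),
      lam (p + 1) (q + 1) j * ((n : ℚ) ^ (j - 1) / (j - 1).factorial) =
      ∑ m ∈ Finset.range (p + q + 1), ((-1) ^ p * (if p ≤ m then (m.choose p : ℚ) else 0) +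
          (-1) ^ q * (if q ≤ m then (m.choose q : ℚ) else 0)) * bernoulli (m + 1) /
            (m + 1).factorial * ((n : ℚ) ^ (p + q - m) / (p + q - m).factorial) := by
    rw [← Finset.sum_range_reflect, show p + 1 + (q + 1) - 1 = p + q + 1 by lia,
      ← Finset.Ico_succ_right_eq_Icc, Finset.sum_Ico_eq_sum_range]
    refine Finset.sum_congr (by simp) fun l hl => ?_
    replace hl : l < p + q + 1 := by simpa using hl
    have e1 : p + q + 1 - 1 - l = p + q - l := by lia
    have e2 : p + 1 + (q + 1) - 1 - (1 + l) = p + q - l := by lia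
    have e3 : p + 1 + (q + 1) - (1 + l) = p + q - l + 1 := by lia
    have e4 : p + q - (p + q - l) = l := by lia
    have hp : (if 1 + l ≤ q + 1 then ((p + q - l).choose (q + 1 - (1 + l)) : ℚ) else 0) =
        if p ≤ p + q - l then ((p + q - l).choose p : ℚ) else 0 := by
      split_ifs with ha hb hb
      · rw [← Nat.choose_symm hb, show q + 1 - (1 + l) = p + q - l - p by lia]
      · lia
      · lia
      · rfl
    have hq : (if 1 + l ≤ p + 1 then ((p + q - l).choose (p + 1 - (1 + l)) : ℚ) else 0) =
        if q ≤ p + q - l then ((p + q - l).choose q : ℚ) else 0 := by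
      split_ifs with ha hb hb
      · rw [← Nat.choose_symm hb, show p + 1 - (1 + l) = p + q - l - q by lia]
      · lia
      · lia
      · rfl
    rw [lam, e2, e3, e1, e4, hp, hq]
    simp only [add_tsub_cancel_right, add_tsub_cancel_left]
  rw [hlam, show p + 1 + (q + 1) - 1 = p + q + 1 by lia]
  rw [hzero] at hbeta
  rw [← add_right_cancel_iff (a := ∑ a ∈ Finset.range n, if a = 0 then
        (a : ℚ) ^ p * ((n : ℚ) - a) ^ q / (p.factorial * q.factorial) else 0), add_right_comm,
    ← hbeta, ← Finset.sum_add_distrib]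
  refine Finset.sum_congr rfl fun a ha => ?_
  rw [Nat.cast_sub (Finset.mem_range.mp ha).le]
  rcases Nat.eq_zero_or_pos a with rfl | h
  · simp
  · rw [if_pos (Nat.one_le_iff_ne_zero.mpr h.ne'), if_neg h.ne']
    simp only [add_tsub_cancel_right]
    ring

theorem coeff_gone_zero (k : ℕ) {N M : ℕ} (hNM : N ≤ M) :
    PowerSeries.coeff N (gone k 0) =
      ∑ m ∈ Finset.range (M + 1), ∑ n ∈ Finset.range (M + 1),
        if 1 ≤ m ∧ 1 ≤ n ∧ m * n = N then (n : ℚ) ^ (k - 1) / (k - 1).factorial else 0 := by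
  have hsub : Finset.range (N + 1) ⊆ Finset.range (M + 1) :=
    Finset.range_subset_range.mpr (by lia)
  rw [gone, PowerSeries.coeff_mk]
  simp only [pow_zero, one_mul]
  refine (Finset.sum_subset hsub ?_).trans (Finset.sum_congr rfl fun m _ =>
    Finset.sum_subset hsub ?_)
  · intro m _ hm
    refine Finset.sum_eq_zero fun n _ => if_neg ?_
    rintro ⟨-, h, rfl⟩
    exact hm (Finset.mem_range.mpr (Nat.lt_succ_of_le (Nat.le_mul_of_pos_right m h)))
  · intro n _ hn
    refine if_neg ?_
    rintro ⟨h, -, rfl⟩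
    exact hn (Finset.mem_range.mpr (Nat.lt_succ_of_le (Nat.le_mul_of_pos_left n h)))

theorem coeff_gone_mul_gone (k1 k2 N : ℕ) :
    PowerSeries.coeff N (gone k1 0 * gone k2 0) =
      ∑ m1 ∈ Finset.range (N + 1), ∑ m2 ∈ Finset.range (N + 1),
        ∑ n1 ∈ Finset.range (N + 1), ∑ n2 ∈ Finset.range (N + 1),
          if 1 ≤ m1 ∧ 1 ≤ m2 ∧ 1 ≤ n1 ∧ 1 ≤ n2 ∧ m1 * n1 + m2 * n2 = N then
            ((n1 : ℚ) ^ (k1 - 1) / (k1 - 1).factorial) *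
              ((n2 : ℚ) ^ (k2 - 1) / (k2 - 1).factorial) else 0 := by
  rw [PowerSeries.coeff_mul]
  have hstep : ∀ x ∈ Finset.HasAntidiagonal.antidiagonal N,
      PowerSeries.coeff x.1 (gone k1 0) * PowerSeries.coeff x.2 (gone k2 0) =
      ∑ m1 ∈ Finset.range (N + 1), ∑ m2 ∈ Finset.range (N + 1),
        ∑ n1 ∈ Finset.range (N + 1), ∑ n2 ∈ Finset.range (N + 1),
          (if 1 ≤ m1 ∧ 1 ≤ n1 ∧ m1 * n1 = x.1 then
            ((n1 : ℚ) ^ (k1 - 1) / (k1 - 1).factorial) else 0) *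
          (if 1 ≤ m2 ∧ 1 ≤ n2 ∧ m2 * n2 = x.2 then
            ((n2 : ℚ) ^ (k2 - 1) / (k2 - 1).factorial) else 0) := by
    intro x hx
    have hx' := Finset.HasAntidiagonal.mem_antidiagonal.mp hx
    rw [coeff_gone_zero k1 (show x.1 ≤ N by lia), coeff_gone_zero k2 (show x.2 ≤ N by lia),
      Finset.sum_mul_sum]
    simp only [Finset.sum_mul_sum]
  rw [Finset.sum_congr rfl hstep, Finset.sum_comm]
  refine Finset.sum_congr rfl fun m1 _ => ?_
  rw [Finset.sum_comm]
  refine Finset.sum_congr rfl fun m2 _ => ?_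
  rw [Finset.sum_comm]
  refine Finset.sum_congr rfl fun n1 _ => ?_
  rw [Finset.sum_comm]
  refine Finset.sum_congr rfl fun n2 _ => ?_
  split_ifs with h
  · obtain ⟨a, b, c, d, e⟩ := h
    rw [Finset.sum_eq_single (m1 * n1, m2 * n2)]
    · simp [*]
    · rintro ⟨u, v⟩ - huv
      rw [ite_zero_mul_ite_zero, if_neg]
      rintro ⟨⟨-, -, rfl⟩, -, -, rfl⟩
      exact huv rfl
    · intro hne
      exact absurd (Finset.HasAntidiagonal.mem_antidiagonal.mpr e) hne
  · refine Finset.sum_eq_zero fun x hx => ?_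
    have hx' := Finset.HasAntidiagonal.mem_antidiagonal.mp hx
    rw [ite_zero_mul_ite_zero, if_neg]
    rintro ⟨⟨a, b, c⟩, d, e, f⟩
    exact h ⟨a, d, b, e, by rw [c, f, hx']⟩

/-- Summation over `n₁, n₂` with the same `m` groups by `n = n₁ + n₂`. -/
theorem sum_sum_mul_add_eq (f : ℕ → ℕ → ℚ) (m N : ℕ) (hm : 1 ≤ m) :
    (∑ n1 ∈ Finset.range (N + 1), ∑ n2 ∈ Finset.range (N + 1),
      if 1 ≤ n1 ∧ 1 ≤ n2 ∧ m * n1 + m * n2 = N then f n1 n2 else 0) =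
    ∑ n ∈ Finset.range (N + 1), if 1 ≤ n ∧ m * n = N then
      ∑ a ∈ Finset.range n, (if 1 ≤ a then f a (n - a) else 0) else 0 := by
  have hle : ∀ n, m * n = N → n ≤ N := fun n h => h ▸ Nat.le_mul_of_pos_left n hm
  simp only [← Finset.sum_filter, Finset.sum_sigma']
  refine Finset.sum_bij' (fun x _ => ⟨x.1 + x.2, x.1⟩) (fun y _ => ⟨y.2, y.1 - y.2⟩) ?_ ?_ ?_ ?_ ?_
  · rintro ⟨a, b⟩ h
    simp only [Finset.mem_sigma, Finset.mem_filter, Finset.mem_range] at h ⊢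
    have := hle (a + b) (by rw [mul_add]; exact h.2.2.2.2)
    exact ⟨⟨by lia, by lia, by rw [mul_add]; exact h.2.2.2.2⟩, by lia, h.2.2.1⟩
  · rintro ⟨n, a⟩ h
    simp only [Finset.mem_sigma, Finset.mem_filter, Finset.mem_range] at h ⊢
    exact ⟨by lia, by lia, h.2.2, by lia, by
      rw [← mul_add, Nat.add_sub_cancel' h.2.1.le]; exact h.1.2.2⟩
  · rintro ⟨a, b⟩ h
    simp
  · rintro ⟨n, a⟩ h
    simp only [Finset.mem_sigma, Finset.mem_filter, Finset.mem_range] at h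
    simp [Nat.add_sub_cancel' h.2.1.le]
  · rintro ⟨a, b⟩ h
    simp

theorem coeff_gone_mul_gone_eq_add_diagonal (k1 k2 N : ℕ) :
    PowerSeries.coeff N (gone k1 0 * gone k2 0) =
      PowerSeries.coeff N (gtwo k1 k2 0 0) + PowerSeries.coeff N (gtwo k2 k1 0 0) +
      ∑ m ∈ Finset.range (N + 1), ∑ n1 ∈ Finset.range (N + 1), ∑ n2 ∈ Finset.range (N + 1),
        if 1 ≤ m ∧ 1 ≤ n1 ∧ 1 ≤ n2 ∧ m * n1 + m * n2 = N then
          ((n1 : ℚ) ^ (k1 - 1) / (k1 - 1).factorial) *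
            ((n2 : ℚ) ^ (k2 - 1) / (k2 - 1).factorial) else 0 := by
  have hswap : PowerSeries.coeff N (gtwo k2 k1 0 0) =
      ∑ m1 ∈ Finset.range (N + 1), ∑ m2 ∈ Finset.range (N + 1),
        ∑ n1 ∈ Finset.range (N + 1), ∑ n2 ∈ Finset.range (N + 1),
          if m1 < m2 ∧ 1 ≤ m1 ∧ 1 ≤ n2 ∧ 1 ≤ n1 ∧ m2 * n2 + m1 * n1 = N then
            ((n2 : ℚ) ^ (k2 - 1) / (k2 - 1).factorial) *
              ((n1 : ℚ) ^ (k1 - 1) / (k1 - 1).factorial) else 0 := by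
    rw [gtwo, PowerSeries.coeff_mk, Finset.sum_comm]
    simp only [pow_zero, one_mul]
    exact Finset.sum_congr rfl fun _ _ => Finset.sum_congr rfl fun _ _ => Finset.sum_comm
  have hdiag : (∑ m ∈ Finset.range (N + 1), ∑ n1 ∈ Finset.range (N + 1),
      ∑ n2 ∈ Finset.range (N + 1), if 1 ≤ m ∧ 1 ≤ n1 ∧ 1 ≤ n2 ∧ m * n1 + m * n2 = N then
          ((n1 : ℚ) ^ (k1 - 1) / (k1 - 1).factorial) *
            ((n2 : ℚ) ^ (k2 - 1) / (k2 - 1).factorial) else 0) =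
      ∑ m1 ∈ Finset.range (N + 1), ∑ m2 ∈ Finset.range (N + 1),
        ∑ n1 ∈ Finset.range (N + 1), ∑ n2 ∈ Finset.range (N + 1),
          if m1 = m2 ∧ 1 ≤ m1 ∧ 1 ≤ n1 ∧ 1 ≤ n2 ∧ m1 * n1 + m1 * n2 = N then
            ((n1 : ℚ) ^ (k1 - 1) / (k1 - 1).factorial) *
              ((n2 : ℚ) ^ (k2 - 1) / (k2 - 1).factorial) else 0 := by
    refine Finset.sum_congr rfl fun m hm => ?_
    refine Eq.trans ?_ (Finset.sum_eq_single_of_mem m hm ?_).symm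
    · simp only [true_and]
    · intro b _ hb
      simp [hb.symm]
  rw [coeff_gone_mul_gone, hswap, hdiag, gtwo, PowerSeries.coeff_mk]
  simp only [← Finset.sum_add_distrib, pow_zero, one_mul]
  refine Finset.sum_congr rfl fun m1 _ => Finset.sum_congr rfl fun m2 _ =>
    Finset.sum_congr rfl fun n1 _ => Finset.sum_congr rfl fun n2 _ => ?_
  rcases lt_trichotomy m1 m2 with h | rfl | h
  · rw [if_neg (c := m2 < m1 ∧ _) (by lia), if_neg (c := m1 = m2 ∧ _) (by lia), zero_add,
      add_zero, mul_comm (_ / _ : ℚ)]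
    exact if_congr ⟨by rintro ⟨a, b, c, d, e⟩; exact ⟨h, a, d, c, by rw [← e, add_comm]⟩,
      by rintro ⟨-, a, d, c, e⟩; exact ⟨a, by lia, c, d, by rw [← e, add_comm]⟩⟩ rfl rfl
  · simp
  · rw [if_neg (c := m1 < m2 ∧ _) (by lia), if_neg (c := m1 = m2 ∧ _) (by lia), add_zero, add_zero]
    exact if_congr ⟨by rintro ⟨a, b, c⟩; exact ⟨h, b, c⟩,
      by rintro ⟨-, b, c⟩; exact ⟨by lia, b, c⟩⟩ rfl rfl

/-- the stuffle product of the `q`-series `g(k₁)` and `g(k₂)`. -/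
theorem stmt_4 (k1 k2 : ℕ) (h1 : 1 ≤ k1) (h2 : 1 ≤ k2) :
    gone k1 0 * gone k2 0 =
      gtwo k1 k2 0 0 + gtwo k2 k1 0 0 + gone (k1 + k2) 0 +
        ∑ j ∈ Finset.Icc 1 (k1 + k2 - 1), lam k1 k2 j • gone j 0 := by
  ext N
  rw [coeff_gone_mul_gone_eq_add_diagonal]
  simp only [map_add, map_sum, PowerSeries.coeff_smul, smul_eq_mul]
  rw [add_assoc _ (PowerSeries.coeff N (gone (k1 + k2) 0))]
  congr 1
  simp only [coeff_gone_zero _ le_rfl, Finset.mul_sum]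
  rw [Finset.sum_comm (s := Finset.Icc 1 _), ← Finset.sum_add_distrib]
  refine Finset.sum_congr rfl fun m _ => ?_
  rw [Finset.sum_comm (s := Finset.Icc 1 _), ← Finset.sum_add_distrib]
  rcases Nat.eq_zero_or_pos m with rfl | hm
  · simp
  have hm' : 1 ≤ m := hm
  simp only [hm', true_and]
  rw [sum_sum_mul_add_eq (fun a b => ((a : ℚ) ^ (k1 - 1) / (k1 - 1).factorial) *
    ((b : ℚ) ^ (k2 - 1) / (k2 - 1).factorial)) m N hm]
  refine Finset.sum_congr rfl fun n _ => ?_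
  split_ifs with h
  · exact sum_convolution k1 k2 n h1 h2 h.1
  · simp
end

section
/- Partition relation in depth two: for all integers k_1, k_2 ≥ 1 and d_1, d_2 ≥ 0, the following identity holds in ℚ[[q]]: g(k_1,k_2; d_1,d_2) = Σ_{a=0}^{d_1} Σ_{b=0}^{k_2−1} ((−1)^b/(a!·b!)) · (d_1!/(k_1−1)!) · ((d_2+a)!/(k_2−1−b)!) · g(d_2+1+a, d_1+1−a; k_2−1−b, k_1−1+b). -/
/-- The tuples `(m₁, m₂, n₁, n₂)` that contribute to the coefficient of `q^N` in `gtwo`. -/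
def gtwoIndex (N : ℕ) : Finset (ℕ × ℕ × ℕ × ℕ) :=
  (Finset.range (N + 1) ×ˢ Finset.range (N + 1) ×ˢ Finset.range (N + 1) ×ˢ
    Finset.range (N + 1)).filter fun p =>
      p.2.1 < p.1 ∧ 1 ≤ p.2.1 ∧ 1 ≤ p.2.2.1 ∧ 1 ≤ p.2.2.2 ∧ p.1 * p.2.2.1 + p.2.1 * p.2.2.2 = N

/-- The range bounds in `gtwoIndex` are implied by the other conditions. -/
theorem mem_gtwoIndex {N m1 m2 n1 n2 : ℕ} :
    (m1, m2, n1, n2) ∈ gtwoIndex N ↔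
      m2 < m1 ∧ 1 ≤ m2 ∧ 1 ≤ n1 ∧ 1 ≤ n2 ∧ m1 * n1 + m2 * n2 = N := by
  simp only [gtwoIndex, Finset.mem_filter, Finset.mem_product, Finset.mem_range,
    and_iff_right_iff_imp]
  rintro ⟨hm, hm2, hn1, hn2, rfl⟩
  refine ⟨?_, ?_, ?_, ?_⟩ <;> nlinarith

theorem coeff_gtwo (k1 k2 d1 d2 N : ℕ) :
    PowerSeries.coeff N (gtwo k1 k2 d1 d2) =
      ∑ p ∈ gtwoIndex N,
        ((p.1 : ℚ) ^ d1 * (p.2.2.1 : ℚ) ^ (k1 - 1) / (Nat.factorial (k1 - 1))) *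
          ((p.2.1 : ℚ) ^ d2 * (p.2.2.2 : ℚ) ^ (k2 - 1) / (Nat.factorial (k2 - 1))) := by
  simp only [gtwo, PowerSeries.coeff_mk, gtwoIndex, Finset.sum_filter, Finset.sum_product]

/-- Conjugation of partitions, `(m₁, m₂, n₁, n₂) ↦ (n₁ + n₂, n₁, m₂, m₁ - m₂)`, permutes the index
set of a fixed coefficient. -/
theorem sum_gtwoIndex_conj {M : Type*} [AddCommMonoid M] (N : ℕ) (f : ℕ × ℕ × ℕ × ℕ → M) :
    ∑ p ∈ gtwoIndex N, f p =
      ∑ p ∈ gtwoIndex N, f (p.2.2.1 + p.2.2.2, p.2.2.1, p.2.1, p.1 - p.2.1) := by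
  have maps : ∀ p ∈ gtwoIndex N,
      (p.2.2.1 + p.2.2.2, p.2.2.1, p.2.1, p.1 - p.2.1) ∈ gtwoIndex N := by
    rintro ⟨m1, m2, n1, n2⟩ hp
    rw [mem_gtwoIndex] at hp ⊢
    obtain ⟨hm, hm2, hn1, hn2, rfl⟩ := hp
    obtain ⟨c, rfl⟩ := Nat.exists_eq_add_of_lt hm
    dsimp only
    refine ⟨by omega, hn1, hm2, by omega, ?_⟩
    rw [show m2 + c + 1 - m2 = c + 1 by omega]
    ring
  have inv : ∀ p ∈ gtwoIndex N,
      (p.2.1 + (p.1 - p.2.1), p.2.1, p.2.2.1, p.2.2.1 + p.2.2.2 - p.2.2.1) = p := by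
    rintro ⟨m1, m2, n1, n2⟩ hp
    rw [mem_gtwoIndex] at hp
    simp only [Prod.mk.injEq, true_and]
    omega
  refine Finset.sum_nbij' (fun p => (p.2.2.1 + p.2.2.2, p.2.2.1, p.2.1, p.1 - p.2.1))
    (fun p => (p.2.2.1 + p.2.2.2, p.2.2.1, p.2.1, p.1 - p.2.1)) maps maps inv inv ?_
  intro p hp
  exact congrArg f (inv p hp).symm

/-- The binomial expansion underlying the partition relation. -/
theorem gtwo_summand_expand (k l d e : ℕ) (x y z w : ℚ) :
    ((z + w) ^ d * y ^ k / (Nat.factorial k)) * (z ^ e * (x - y) ^ l / (Nat.factorial l)) =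
      ∑ a ∈ Finset.range (d + 1), ∑ b ∈ Finset.range (l + 1),
        (((-1 : ℚ) ^ b / (Nat.factorial a * Nat.factorial b)) *
            ((Nat.factorial d : ℚ) / (Nat.factorial k)) *
            ((Nat.factorial (e + a) : ℚ) / (Nat.factorial (l - b)))) *
          ((x ^ (l - b) * z ^ (e + a) / (Nat.factorial (e + a))) *
            (y ^ (k + b) * w ^ (d - a) / (Nat.factorial (d - a)))) := by
  have hfac : ∀ n : ℕ, (Nat.factorial n : ℚ) ≠ 0 := fun n => by positivity
  rw [show x - y = -y + x by ring, add_pow, add_pow]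
  simp only [Finset.sum_mul, Finset.mul_sum, Finset.sum_div]
  rw [Finset.sum_comm]
  refine Finset.sum_congr rfl fun a ha => Finset.sum_congr rfl fun b hb => ?_
  rw [Finset.mem_range] at ha hb
  rw [Nat.cast_choose ℚ (Nat.le_of_lt_succ ha), Nat.cast_choose ℚ (Nat.le_of_lt_succ hb),
    neg_pow y b]
  have := hfac k
  have := hfac l
  have := hfac a
  have := hfac b
  have := hfac (d - a)
  have := hfac (l - b)
  have := hfac (e + a)
  field_simp
  ring

/-- the partition relation in depth two. -/
theorem stmt_9 (k1 k2 d1 d2 : ℕ) (h1 : 1 ≤ k1) (h2 : 1 ≤ k2) :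
    gtwo k1 k2 d1 d2 =
      ∑ a ∈ Finset.range (d1 + 1), ∑ b ∈ Finset.range k2,
        (((-1 : ℚ) ^ b / (Nat.factorial a * Nat.factorial b)) *
            ((Nat.factorial d1 : ℚ) / (Nat.factorial (k1 - 1))) *
            ((Nat.factorial (d2 + a) : ℚ) / (Nat.factorial (k2 - 1 - b)))) •
          gtwo (d2 + 1 + a) (d1 + 1 - a) (k2 - 1 - b) (k1 - 1 + b) := by
  obtain ⟨k, rfl⟩ := Nat.exists_eq_add_of_le' h1
  obtain ⟨l, rfl⟩ := Nat.exists_eq_add_of_le' h2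
  ext N
  simp only [map_sum, PowerSeries.coeff_smul, coeff_gtwo, Nat.add_sub_cancel, smul_eq_mul,
    Finset.mul_sum]
  rw [sum_gtwoIndex_conj]
  simp_rw [Finset.sum_comm (t := gtwoIndex N)]
  refine Finset.sum_congr rfl fun p hp => ?_
  obtain ⟨m1, m2, n1, n2⟩ := p
  rw [mem_gtwoIndex] at hp
  simp only [Nat.cast_add, Nat.cast_sub hp.1.le]
  rw [gtwo_summand_expand]
  refine Finset.sum_congr rfl fun a _ => Finset.sum_congr rfl fun b _ => ?_
  rw [show d2 + 1 + a - 1 = d2 + a by omega, show d1 + 1 - a - 1 = d1 - a by omega]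
end

section
/- Shuffle product analogue: for all integers k_1, k_2 ≥ 1 and d_1, d_2 ≥ 0, the following identity holds in ℚ[[q]]: g(k_1; d_1)·g(k_2; d_2) = Σ_{l_1+l_2=k_1+k_2, l_1,l_2≥1} Σ_{e_1+e_2=d_1+d_2, e_1,e_2≥0} (C(l_1−1,k_1−1)·C(d_1,e_1)·(−1)^{d_1−e_1} + C(l_1−1,k_2−1)·C(d_2,e_1)·(−1)^{d_2−e_1}) · g(l_1,l_2; e_1,e_2) + (d_1!·d_2!/(d_1+d_2+1)!)·C(k_1+k_2−2,k_1−1)·g(k_1+k_2−1; d_1+d_2+1) + d_1!·d_2!·C(k_1+k_2−2,k_1−1)·Σ_{j=1}^{d_1+d_2+1} (λ^j_{d_1+1,d_2+1}/(j−1)!) · g(k_1+k_2−1; j−1). -/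
section ShuffleProduct

open scoped Nat

open Finset

/-- Power sums `∑_{0 < a < u} a^d` in terms of Bernoulli numbers. -/
lemma sum_Ico_pow_eq (d u : ℕ) (hu : 1 ≤ u) :
    ∑ a ∈ Ico 1 u, (a : ℚ) ^ d / (d ! : ℚ) =
      (u : ℚ) ^ (d + 1) / ((d + 1)! : ℚ) +
        ∑ n ∈ Icc 1 (d + 1),
          ((-1 : ℚ) ^ d * ((n - 1).choose d : ℚ) + 1) * (bernoulli n / (n ! : ℚ)) *
            ((u : ℚ) ^ (d + 1 - n) / ((d + 1 - n)! : ℚ)) := by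
  have hF := sum_range_pow u d
  have h0 : ∑ a ∈ range u, (a : ℚ) ^ d = (0 : ℚ) ^ d + ∑ a ∈ Ico 1 u, (a : ℚ) ^ d := by
    rw [range_eq_Ico, sum_eq_sum_Ico_succ_bot (by omega)]; simp
  have h1 : ∑ a ∈ Ico 1 u, (a : ℚ) ^ d / (d ! : ℚ) =
      (∑ i ∈ range (d + 1),
        (bernoulli i / (i ! : ℚ)) * ((u : ℚ) ^ (d + 1 - i) / ((d + 1 - i)! : ℚ))) -
        (0 : ℚ) ^ d / (d ! : ℚ) := by
    rw [← sum_div, eq_sub_iff_add_eq, ← add_div, add_comm, ← h0, hF, sum_div]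
    refine sum_congr rfl fun i hi => ?_
    have hi' : i ≤ d + 1 := by have := mem_range.1 hi; omega
    rw [Nat.cast_choose ℚ hi', Nat.factorial_succ d]
    have := Nat.factorial_ne_zero d
    have := Nat.factorial_ne_zero i
    have := Nat.factorial_ne_zero (d + 1 - i)
    push_cast
    field_simp
  have h2 : ∑ n ∈ Icc 1 (d + 1),
          ((-1 : ℚ) ^ d * ((n - 1).choose d : ℚ) + 1) * (bernoulli n / (n ! : ℚ)) *
            ((u : ℚ) ^ (d + 1 - n) / ((d + 1 - n)! : ℚ)) =
      (∑ n ∈ Ico 1 (d + 1),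
        (bernoulli n / (n ! : ℚ)) * ((u : ℚ) ^ (d + 1 - n) / ((d + 1 - n)! : ℚ))) +
        ((-1 : ℚ) ^ d + 1) * (bernoulli (d + 1) / ((d + 1)! : ℚ)) := by
    rw [← Ico_add_one_right_eq_Icc, sum_Ico_succ_top (by omega)]
    congr 1
    · refine sum_congr rfl fun n hn => ?_
      rw [mem_Ico] at hn
      rw [Nat.choose_eq_zero_of_lt (by omega)]; simp
    · simp
  have h3 : ((-1 : ℚ) ^ d + 1) * (bernoulli (d + 1) / ((d + 1)! : ℚ)) =
      -((0 : ℚ) ^ d / (d ! : ℚ)) := by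
    rcases Nat.even_or_odd d with hd | hd
    · rcases Nat.eq_zero_or_pos d with rfl | hpos
      · norm_num
      · rw [bernoulli_eq_zero_of_odd hd.add_one (by omega), zero_pow (by omega)]; simp
    · rw [hd.neg_one_pow, zero_pow hd.pos.ne']; simp
  rw [h1, h2, h3, range_eq_Ico, sum_eq_sum_Ico_succ_bot (by omega)]
  simp
  ring

/-- The truncated beta-type sum `∑_{a + b = u, a, b ≥ 1} a^d b^e` in terms of Bernoulli numbers. -/
lemma sum_Ico_pow_mul_pow_eq (u : ℕ) (hu : 1 ≤ u) (e d : ℕ) :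
    ∑ a ∈ Ico 1 u, ((a : ℚ) ^ d / (d ! : ℚ)) * (((u : ℚ) - a) ^ e / (e ! : ℚ)) =
      (u : ℚ) ^ (d + e + 1) / ((d + e + 1)! : ℚ) +
        ∑ n ∈ Icc 1 (d + e + 1),
          ((-1 : ℚ) ^ d * ((n - 1).choose d : ℚ) + (-1 : ℚ) ^ e * ((n - 1).choose e : ℚ)) *
            (bernoulli n / (n ! : ℚ)) *
            ((u : ℚ) ^ (d + e + 1 - n) / ((d + e + 1 - n)! : ℚ)) := by
  induction e generalizing d with
  | zero => simpa using sum_Ico_pow_eq d u hu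
  | succ e ih =>
    have he : ((e : ℚ) + 1) ≠ 0 := by positivity
    have hrec : ((e : ℚ) + 1) *
        ∑ a ∈ Ico 1 u, ((a : ℚ) ^ d / (d ! : ℚ)) * (((u : ℚ) - a) ^ (e + 1) / ((e + 1)! : ℚ)) =
        u * ∑ a ∈ Ico 1 u, ((a : ℚ) ^ d / (d ! : ℚ)) * (((u : ℚ) - a) ^ e / (e ! : ℚ)) -
        (d + 1) * ∑ a ∈ Ico 1 u,
          ((a : ℚ) ^ (d + 1) / ((d + 1)! : ℚ)) * (((u : ℚ) - a) ^ e / (e ! : ℚ)) := by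
      rw [mul_sum, mul_sum, mul_sum, ← sum_sub_distrib]
      refine sum_congr rfl fun a _ => ?_
      rw [Nat.factorial_succ e, Nat.factorial_succ d]
      have := Nat.factorial_ne_zero d
      have := Nat.factorial_ne_zero e
      push_cast
      field_simp
      ring
    refine mul_left_cancel₀ he ?_
    rw [hrec, ih d, ih (d + 1), show d + 1 + e + 1 = d + e + 2 by ring,
      show d + (e + 1) + 1 = d + e + 2 by ring]
    have hext : (u : ℚ) * ∑ n ∈ Icc 1 (d + e + 1),
          ((-1 : ℚ) ^ d * ((n - 1).choose d : ℚ) + (-1 : ℚ) ^ e * ((n - 1).choose e : ℚ)) *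
            (bernoulli n / (n ! : ℚ)) *
            ((u : ℚ) ^ (d + e + 1 - n) / ((d + e + 1 - n)! : ℚ)) =
        ∑ n ∈ Icc 1 (d + e + 2), ((d : ℚ) + e + 2 - n) *
          (((-1 : ℚ) ^ d * ((n - 1).choose d : ℚ) + (-1 : ℚ) ^ e * ((n - 1).choose e : ℚ)) *
            (bernoulli n / (n ! : ℚ)) *
            ((u : ℚ) ^ (d + e + 2 - n) / ((d + e + 2 - n)! : ℚ))) := by
      rw [show d + e + 2 = (d + e + 1) + 1 by ring, sum_Icc_succ_top (by omega : 1 ≤ d + e + 1 + 1),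
        mul_sum]
      have hz : ((d : ℚ) + e + 2 - ((d + e + 1 + 1 : ℕ) : ℚ)) = 0 := by push_cast; ring
      rw [hz, zero_mul, add_zero]
      refine sum_congr rfl fun n hn => ?_
      rw [mem_Icc] at hn
      obtain ⟨c, hc⟩ := Nat.exists_eq_add_of_le hn.2
      have hcq : (d : ℚ) + e + 2 - n = c + 1 := by
        have : ((d + e + 1 : ℕ) : ℚ) = ((n + c : ℕ) : ℚ) := by rw [hc]
        push_cast at this; linarith
      rw [hcq, show d + e + 1 + 1 - n = c + 1 by omega, show d + e + 1 - n = c by omega,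
        Nat.factorial_succ c]
      have := Nat.factorial_ne_zero c
      push_cast
      field_simp
      ring
    have hlead : (u : ℚ) * ((u : ℚ) ^ (d + e + 1) / ((d + e + 1)! : ℚ)) =
        ((d : ℚ) + e + 2) * ((u : ℚ) ^ (d + e + 2) / ((d + e + 2)! : ℚ)) := by
      rw [Nat.factorial_succ (d + e + 1)]
      have := Nat.factorial_ne_zero (d + e + 1)
      have : (d : ℚ) + e + 2 ≠ 0 := by positivity
      push_cast
      rw [show (d : ℚ) + e + 1 + 1 = d + e + 2 by ring]
      field_simp
      ring
    have hcoef : ∀ n ∈ Icc 1 (d + e + 2),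
        ((d : ℚ) + e + 2 - n) *
          (((-1 : ℚ) ^ d * ((n - 1).choose d : ℚ) + (-1 : ℚ) ^ e * ((n - 1).choose e : ℚ)) *
            (bernoulli n / (n ! : ℚ)) *
            ((u : ℚ) ^ (d + e + 2 - n) / ((d + e + 2 - n)! : ℚ))) =
        (d + 1) * (((-1 : ℚ) ^ (d + 1) * ((n - 1).choose (d + 1) : ℚ) +
            (-1 : ℚ) ^ e * ((n - 1).choose e : ℚ)) *
            (bernoulli n / (n ! : ℚ)) *
            ((u : ℚ) ^ (d + e + 2 - n) / ((d + e + 2 - n)! : ℚ))) +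
        (e + 1) * (((-1 : ℚ) ^ d * ((n - 1).choose d : ℚ) +
            (-1 : ℚ) ^ (e + 1) * ((n - 1).choose (e + 1) : ℚ)) *
            (bernoulli n / (n ! : ℚ)) *
            ((u : ℚ) ^ (d + e + 2 - n) / ((d + e + 2 - n)! : ℚ))) := by
      intro n hn
      obtain ⟨m, rfl⟩ : ∃ m, n = m + 1 := ⟨n - 1, by rw [mem_Icc] at hn; omega⟩
      have key : ∀ j : ℕ, ((m.choose (j + 1) : ℕ) : ℚ) * (j + 1) = (m.choose j : ℚ) * (m - j) := by
        intro j
        rcases le_or_gt j m with h | h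
        · have := Nat.choose_succ_right_eq m j
          have h' : ((m.choose (j + 1) * (j + 1) : ℕ) : ℚ) = ((m.choose j * (m - j) : ℕ) : ℚ) := by
            rw [this]
          push_cast [Nat.cast_sub h] at h'
          exact h'
        · rw [Nat.choose_eq_zero_of_lt h, Nat.choose_eq_zero_of_lt (by omega)]; simp
      have kd := key d
      have ke := key e
      simp only [Nat.add_sub_cancel]
      generalize bernoulli (m + 1) / ((m + 1)! : ℚ) = b
      generalize (u : ℚ) ^ (d + e + 2 - (m + 1)) / ((d + e + 2 - (m + 1))! : ℚ) = w
      push_cast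
      rw [pow_succ, pow_succ]
      linear_combination (b * w * (-1) ^ d) * kd + (b * w * (-1) ^ e) * ke
    rw [mul_add, hlead, hext, sum_congr rfl hcoef, sum_add_distrib, ← mul_sum, ← mul_sum]
    ring

/-- The same identity, with the Bernoulli terms expressed through `lam`. -/
lemma sum_Ico_pow_mul_pow_eq_lam (d e u : ℕ) (hu : 1 ≤ u) :
    ∑ a ∈ Ico 1 u, (a : ℚ) ^ d * ((u : ℚ) - a) ^ e =
      (d ! * e ! : ℚ) / ((d + e + 1)! : ℚ) * (u : ℚ) ^ (d + e + 1) +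
        (d ! * e ! : ℚ) * ∑ j ∈ Icc 1 (d + e + 1),
          lam (d + 1) (e + 1) j / ((j - 1)! : ℚ) * (u : ℚ) ^ (j - 1) := by
  have hd : (d ! : ℚ) ≠ 0 := by exact_mod_cast Nat.factorial_ne_zero d
  have he : (e ! : ℚ) ≠ 0 := by exact_mod_cast Nat.factorial_ne_zero e
  have h1 : ∑ a ∈ Ico 1 u, (a : ℚ) ^ d * ((u : ℚ) - a) ^ e = (d ! * e ! : ℚ) *
      ∑ a ∈ Ico 1 u, ((a : ℚ) ^ d / (d ! : ℚ)) * (((u : ℚ) - a) ^ e / (e ! : ℚ)) := by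
    rw [mul_sum]
    refine sum_congr rfl fun a _ => ?_
    field_simp
  rw [h1, sum_Ico_pow_mul_pow_eq u hu, mul_add]
  congr 1
  · ring
  congr 1
  refine sum_bij' (fun n _ => d + e + 2 - n) (fun j _ => d + e + 2 - j) ?_ ?_ ?_ ?_ ?_
  · intro n hn; rw [mem_Icc] at *; omega
  · intro n hn; rw [mem_Icc] at *; omega
  · intro n hn; rw [mem_Icc] at *; omega
  · intro n hn; rw [mem_Icc] at *; omega
  · intro n hn
    rw [mem_Icc] at hn
    have c1 : (if d + e + 2 - n ≤ e + 1 then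
        ((d + 1 + (e + 1) - 1 - (d + e + 2 - n)).choose (e + 1 - (d + e + 2 - n)) : ℚ) else 0) =
        ((n - 1).choose d : ℚ) := by
      split_ifs with h
      · rw [show d + 1 + (e + 1) - 1 - (d + e + 2 - n) = n - 1 by omega,
          show e + 1 - (d + e + 2 - n) = n - 1 - d by omega, Nat.choose_symm (by omega)]
      · rw [Nat.choose_eq_zero_of_lt (by omega)]; simp
    have c2 : (if d + e + 2 - n ≤ d + 1 then
        ((d + 1 + (e + 1) - 1 - (d + e + 2 - n)).choose (d + 1 - (d + e + 2 - n)) : ℚ) else 0) =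
        ((n - 1).choose e : ℚ) := by
      split_ifs with h
      · rw [show d + 1 + (e + 1) - 1 - (d + e + 2 - n) = n - 1 by omega,
          show d + 1 - (d + e + 2 - n) = n - 1 - e by omega, Nat.choose_symm (by omega)]
      · rw [Nat.choose_eq_zero_of_lt (by omega)]; simp
    rw [lam, c1, c2, show d + 1 + (e + 1) - (d + e + 2 - n) = n by omega,
      show d + e + 2 - n - 1 = d + e + 1 - n by omega]
    simp only [Nat.add_sub_cancel]
    ring

/-- The quadruples `(u₁, v₁, u₂, v₂)` of positive integers with `u₁v₁ + u₂v₂ = N`. -/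
def quadruples (N : ℕ) : Finset (ℕ × ℕ × ℕ × ℕ) :=
  (range (N + 1) ×ˢ range (N + 1) ×ˢ range (N + 1) ×ˢ range (N + 1)).filter fun x =>
    1 ≤ x.1 ∧ 1 ≤ x.2.1 ∧ 1 ≤ x.2.2.1 ∧ 1 ≤ x.2.2.2 ∧ x.1 * x.2.1 + x.2.2.1 * x.2.2.2 = N

lemma mem_quadruples {N : ℕ} {x : ℕ × ℕ × ℕ × ℕ} :
    x ∈ quadruples N ↔
      1 ≤ x.1 ∧ 1 ≤ x.2.1 ∧ 1 ≤ x.2.2.1 ∧ 1 ≤ x.2.2.2 ∧ x.1 * x.2.1 + x.2.2.1 * x.2.2.2 = N := by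
  obtain ⟨a, b, c, d⟩ := x
  simp only [quadruples, mem_filter, mem_product, mem_range, and_iff_right_iff_imp]
  rintro ⟨ha, hb, hc, hd, rfl⟩
  refine ⟨?_, ?_, ?_, ?_⟩ <;> nlinarith [Nat.mul_le_mul ha hb, Nat.mul_le_mul hc hd]

/-- The summand of `gone k d`. -/
noncomputable def goneTerm (k d m n : ℕ) : ℚ :=
  (m : ℚ) ^ d * (n : ℚ) ^ (k - 1) / ((k - 1)! : ℚ)

lemma coeff_gone (k d N : ℕ) {B : ℕ} (hB : N ≤ B) :
    PowerSeries.coeff N (gone k d) =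
      ∑ x ∈ (range (B + 1) ×ˢ range (B + 1)).filter
        (fun x => 1 ≤ x.1 ∧ 1 ≤ x.2 ∧ x.1 * x.2 = N), goneTerm k d x.1 x.2 := by
  rw [gone, PowerSeries.coeff_mk, ← sum_product', ← sum_filter]
  refine sum_congr ?_ fun _ _ => rfl
  ext ⟨a, b⟩
  simp only [mem_filter, mem_product, mem_range]
  constructor
  · rintro ⟨h, h'⟩
    exact ⟨by omega, h'⟩
  · rintro ⟨_, ha, hb, rfl⟩
    refine ⟨⟨?_, ?_⟩, ha, hb, rfl⟩ <;> nlinarith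

lemma coeff_gone_mul_gone_s10 (k1 k2 d1 d2 N : ℕ) :
    PowerSeries.coeff N (gone k1 d1 * gone k2 d2) =
      ∑ x ∈ quadruples N, goneTerm k1 d1 x.1 x.2.1 * goneTerm k2 d2 x.2.2.1 x.2.2.2 := by
  rw [PowerSeries.coeff_mul]
  have h : ∀ p ∈ antidiagonal N,
      PowerSeries.coeff p.1 (gone k1 d1) * PowerSeries.coeff p.2 (gone k2 d2) =
      ∑ x ∈ (quadruples N).filter (fun x => (x.1 * x.2.1, x.2.2.1 * x.2.2.2) = p),
        goneTerm k1 d1 x.1 x.2.1 * goneTerm k2 d2 x.2.2.1 x.2.2.2 := by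
    rintro ⟨p, q⟩ hp
    rw [HasAntidiagonal.mem_antidiagonal] at hp
    simp only at hp ⊢
    rw [coeff_gone k1 d1 p (B := N) (by omega), coeff_gone k2 d2 q (B := N) (by omega),
      sum_mul_sum, ← sum_product']
    refine sum_bij' (fun y _ => (y.1.1, y.1.2, y.2.1, y.2.2))
      (fun x _ => ((x.1, x.2.1), (x.2.2.1, x.2.2.2))) ?_ ?_ ?_ ?_ ?_
    · rintro ⟨⟨a, b⟩, c, d⟩ hy
      simp only [mem_product, mem_filter, mem_range, mem_quadruples, Prod.mk.injEq] at hy ⊢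
      obtain ⟨⟨_, ha, hb, rfl⟩, _, hc, hd, rfl⟩ := hy
      exact ⟨⟨ha, hb, hc, hd, hp⟩, rfl, rfl⟩
    · rintro ⟨a, b, c, d⟩ hx
      simp only [mem_filter, Prod.mk.injEq] at hx
      have hm := mem_quadruples.1 hx.1
      obtain ⟨hx, hpq⟩ := hx
      simp only [quadruples, mem_filter, mem_product, mem_range] at hx hm ⊢
      exact ⟨⟨⟨hx.1.1, hx.1.2.1⟩, hm.1, hm.2.1, hpq.1⟩, hx.1.2.2, hm.2.2.1, hm.2.2.2.1, hpq.2⟩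
    · intros; rfl
    · intros; rfl
    · intros; rfl
  rw [sum_congr rfl h]
  refine sum_fiberwise_of_maps_to (g := fun x : ℕ × ℕ × ℕ × ℕ => (x.1 * x.2.1, x.2.2.1 * x.2.2.2))
    (fun x hx => ?_) _
  rw [HasAntidiagonal.mem_antidiagonal]
  exact (mem_quadruples.1 hx).2.2.2.2

lemma coeff_gtwo_s10 (k1 k2 d1 d2 N : ℕ) :
    PowerSeries.coeff N (gtwo k1 k2 d1 d2) =
      ∑ x ∈ (quadruples N).filter (fun x => x.2.2.1 < x.1),
        goneTerm k1 d1 x.1 x.2.1 * goneTerm k2 d2 x.2.2.1 x.2.2.2 := by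
  rw [gtwo, PowerSeries.coeff_mk]
  simp_rw [← sum_product', ← sum_filter]
  refine sum_bij' (fun x _ => (x.1, x.2.2.1, x.2.1, x.2.2.2))
    (fun x _ => (x.1, x.2.2.1, x.2.1, x.2.2.2)) ?_ ?_ ?_ ?_ ?_
  · rintro ⟨a, b, c, d⟩ hx
    simp only [mem_filter, mem_quadruples] at hx ⊢
    obtain ⟨_, hlt, hb, hc, hd, h⟩ := hx
    exact ⟨⟨by omega, hc, hb, hd, h⟩, hlt⟩
  · rintro ⟨a, b, c, d⟩ hx
    simp only [mem_filter, quadruples, mem_product] at hx ⊢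
    tauto
  · intros; rfl
  · intros; rfl
  · intros; rfl

/-- The change of variables `u₁v₁ + u₂v₂ = (u₁ + u₂)v₂ + u₁(v₁ - v₂)` on the region `v₂ < v₁`. -/
lemma sum_quadruples_filter_lt (N : ℕ) (f : ℕ → ℕ → ℕ → ℕ → ℚ) :
    ∑ x ∈ (quadruples N).filter (fun x => x.2.2.2 < x.2.1), f x.1 x.2.1 x.2.2.1 x.2.2.2 =
      ∑ x ∈ (quadruples N).filter (fun x => x.2.2.1 < x.1),
        f x.2.2.1 (x.2.1 + x.2.2.2) (x.1 - x.2.2.1) x.2.1 := by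
  refine sum_bij' (fun x _ => (x.1 + x.2.2.1, x.2.2.2, x.1, x.2.1 - x.2.2.2))
    (fun x _ => (x.2.2.1, x.2.1 + x.2.2.2, x.1 - x.2.2.1, x.2.1)) ?_ ?_ ?_ ?_ ?_
  · rintro ⟨a, b, c, d⟩ hx
    simp only [mem_filter, mem_quadruples] at hx ⊢
    obtain ⟨⟨ha, hb, hc, hd, h⟩, hlt⟩ := hx
    obtain ⟨t, rfl⟩ := Nat.exists_eq_add_of_lt hlt
    refine ⟨⟨by omega, hd, ha, by omega, ?_⟩, by omega⟩
    rw [show d + t + 1 - d = t + 1 by omega, ← h]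
    ring
  · rintro ⟨a, b, c, d⟩ hx
    simp only [mem_filter, mem_quadruples] at hx ⊢
    obtain ⟨⟨ha, hb, hc, hd, h⟩, hlt⟩ := hx
    obtain ⟨t, rfl⟩ := Nat.exists_eq_add_of_lt hlt
    refine ⟨⟨hc, by omega, by omega, hb, ?_⟩, by omega⟩
    rw [show c + t + 1 - c = t + 1 by omega, ← h]
    ring
  · rintro ⟨a, b, c, d⟩ hx
    have hlt : d < b := (mem_filter.1 hx).2
    simp only [Prod.mk.injEq, and_true, true_and]
    omega
  · rintro ⟨a, b, c, d⟩ hx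
    have hlt : c < a := (mem_filter.1 hx).2
    simp only [Prod.mk.injEq, true_and]
    omega
  · rintro ⟨a, b, c, d⟩ hx
    have hlt : d < b := (mem_filter.1 hx).2
    simp only [Nat.add_sub_cancel_left, Nat.add_sub_cancel' hlt.le]

lemma sum_quadruples_filter_gt (N : ℕ) (f : ℕ → ℕ → ℕ → ℕ → ℚ) :
    ∑ x ∈ (quadruples N).filter (fun x => x.2.1 < x.2.2.2), f x.1 x.2.1 x.2.2.1 x.2.2.2 =
      ∑ x ∈ (quadruples N).filter (fun x => x.2.2.2 < x.2.1), f x.2.2.1 x.2.2.2 x.1 x.2.1 := by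
  refine sum_bij' (fun x _ => (x.2.2.1, x.2.2.2, x.1, x.2.1))
    (fun x _ => (x.2.2.1, x.2.2.2, x.1, x.2.1)) ?_ ?_ ?_ ?_ ?_
  · rintro ⟨a, b, c, d⟩ hx
    simp only [mem_filter, mem_quadruples] at hx ⊢
    rw [add_comm (c * d)]; tauto
  · rintro ⟨a, b, c, d⟩ hx
    simp only [mem_filter, mem_quadruples] at hx ⊢
    rw [add_comm (c * d)]; tauto
  · intros; rfl
  · intros; rfl
  · intros; rfl

lemma sum_quadruples_filter_eq (N : ℕ) (f : ℕ → ℕ → ℕ → ℕ → ℚ) :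
    ∑ x ∈ (quadruples N).filter (fun x => x.2.1 = x.2.2.2), f x.1 x.2.1 x.2.2.1 x.2.2.2 =
      ∑ x ∈ (range (N + 1) ×ˢ range (N + 1)).filter
        (fun x => 1 ≤ x.1 ∧ 1 ≤ x.2 ∧ x.1 * x.2 = N),
        ∑ a ∈ Ico 1 x.1, f a x.2 (x.1 - a) x.2 := by
  rw [sum_sigma']
  refine sum_bij' (fun x _ => ⟨(x.1 + x.2.2.1, x.2.1), x.1⟩)
    (fun y _ => (y.2, y.1.2, y.1.1 - y.2, y.1.2)) ?_ ?_ ?_ ?_ ?_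
  · rintro ⟨a, b, c, d⟩ hx
    simp only [mem_filter, mem_quadruples] at hx
    obtain ⟨⟨ha, hb, hc, hd, h⟩, rfl⟩ := hx
    have h' : (a + c) * b = N := by rw [← h]; ring
    simp only [mem_sigma, mem_filter, mem_product, mem_range, mem_Ico]
    refine ⟨⟨⟨?_, ?_⟩, by omega, hb, h'⟩, ha, by omega⟩ <;> nlinarith
  · rintro ⟨⟨m, n⟩, a⟩ hy
    simp only [mem_sigma, mem_filter, mem_product, mem_range, mem_Ico] at hy
    obtain ⟨⟨_, hm, hn, h⟩, ha, ham⟩ := hy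
    simp only [mem_filter, mem_quadruples, and_true]
    refine ⟨ha, hn, by omega, hn, ?_⟩
    rw [← add_mul, Nat.add_sub_cancel' ham.le, h]
  · rintro ⟨a, b, c, d⟩ hx
    have h : b = d := (mem_filter.1 hx).2
    simp only [Prod.mk.injEq, true_and]
    omega
  · rintro ⟨⟨m, n⟩, a⟩ hy
    simp only [mem_sigma, mem_Ico] at hy
    simp only [Nat.add_sub_cancel' hy.2.2.le]
  · rintro ⟨a, b, c, d⟩ hx
    have h : b = d := (mem_filter.1 hx).2
    simp only [Nat.add_sub_cancel_left, h]

lemma add_pow_mul_pow_div_factorial (x y : ℚ) (p q : ℕ) :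
    (x + y) ^ p / (p ! : ℚ) * (x ^ q / (q ! : ℚ)) =
      ∑ l ∈ Icc 1 (p + q + 1), ((l - 1).choose q : ℚ) *
        (x ^ (l - 1) / ((l - 1)! : ℚ) * (y ^ (p + q + 1 - l) / ((p + q + 1 - l)! : ℚ))) := by
  have hq : ∀ n : ℕ, (n ! : ℚ) ≠ 0 := fun n => by exact_mod_cast Nat.factorial_ne_zero n
  rw [← Ico_add_one_right_eq_Icc, sum_Ico_eq_sum_range, show p + q + 1 + 1 - 1 = q + (p + 1) by omega,
    sum_range_add, sum_eq_zero, zero_add, add_pow, sum_div, sum_mul]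
  · refine sum_congr rfl fun i hi => ?_
    have hi : i ≤ p := by rw [mem_range] at hi; omega
    rw [show 1 + (q + i) - 1 = q + i by omega, show p + q + 1 - (1 + (q + i)) = p - i by omega,
      Nat.cast_choose ℚ hi, Nat.cast_add_choose]
    have := hq p; have := hq q; have := hq i; have := hq (p - i); have := hq (q + i)
    rw [pow_add]
    field_simp
  · intro i hi
    rw [mem_range] at hi
    rw [Nat.choose_eq_zero_of_lt (by omega)]; simp

lemma pow_mul_sub_pow (x y : ℚ) (d e : ℕ) :
    y ^ d * (x - y) ^ e =
      ∑ i ∈ range (d + e + 1), (e.choose i : ℚ) * (-1) ^ (e - i) * (x ^ i * y ^ (d + e - i)) := by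
  rw [show d + e + 1 = (e + 1) + d by ring, sum_range_add, sub_eq_add_neg, add_pow, mul_sum,
    sum_eq_zero (s := range d), add_zero]
  · refine sum_congr rfl fun i hi => ?_
    have hi : i ≤ e := by rw [mem_range] at hi; omega
    rw [show d + e - i = d + (e - i) by omega, pow_add, neg_pow y]
    ring
  · intro i _
    rw [Nat.choose_eq_zero_of_lt (by omega)]; simp

/-- The contribution of the region `v₂ < v₁` to the product. -/
lemma sum_quadruples_lt_eq (p q d1 d2 N : ℕ) :
    ∑ x ∈ (quadruples N).filter (fun x => x.2.2.2 < x.2.1),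
        goneTerm (p + 1) d1 x.1 x.2.1 * goneTerm (q + 1) d2 x.2.2.1 x.2.2.2 =
      ∑ l ∈ Icc 1 (p + q + 1), ∑ e ∈ range (d1 + d2 + 1),
        (((l - 1).choose q : ℚ) * (d2.choose e : ℚ) * (-1) ^ (d2 - e)) *
          PowerSeries.coeff N (gtwo l (p + q + 2 - l) e (d1 + d2 - e)) := by
  have hterm : ∀ x ∈ (quadruples N).filter (fun x => x.2.2.1 < x.1),
      goneTerm (p + 1) d1 x.2.2.1 (x.2.1 + x.2.2.2) *
        goneTerm (q + 1) d2 (x.1 - x.2.2.1) x.2.1 =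
      ∑ l ∈ Icc 1 (p + q + 1), ∑ e ∈ range (d1 + d2 + 1),
        (((l - 1).choose q : ℚ) * (d2.choose e : ℚ) * (-1) ^ (d2 - e)) *
          (goneTerm l e x.1 x.2.1 * goneTerm (p + q + 2 - l) (d1 + d2 - e) x.2.2.1 x.2.2.2) := by
    rintro ⟨a, b, c, d⟩ hx
    have hlt : c < a := (mem_filter.1 hx).2
    have hsplit : goneTerm (p + 1) d1 c (b + d) * goneTerm (q + 1) d2 (a - c) b =
        (((b : ℚ) + d) ^ p / (p ! : ℚ) * ((b : ℚ) ^ q / (q ! : ℚ))) *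
          ((c : ℚ) ^ d1 * ((a : ℚ) - c) ^ d2) := by
      simp only [goneTerm, Nat.add_sub_cancel, Nat.cast_sub hlt.le, Nat.cast_add]
      ring
    simp only
    rw [hsplit, add_pow_mul_pow_div_factorial, pow_mul_sub_pow, sum_mul_sum]
    refine sum_congr rfl fun l hl => sum_congr rfl fun e _ => ?_
    rw [goneTerm, goneTerm, show p + q + 2 - l - 1 = p + q + 1 - l by omega]
    ring
  rw [sum_quadruples_filter_lt N fun a b c d => goneTerm (p + 1) d1 a b * goneTerm (q + 1) d2 c d,
    sum_congr rfl hterm, sum_comm]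
  refine sum_congr rfl fun l _ => ?_
  rw [sum_comm]
  refine sum_congr rfl fun e _ => ?_
  rw [coeff_gtwo_s10, mul_sum]

/-- The contribution of the diagonal `v₁ = v₂` to the product. -/
lemma sum_quadruples_eq_eq (p q d1 d2 N : ℕ) :
    ∑ x ∈ (quadruples N).filter (fun x => x.2.1 = x.2.2.2),
        goneTerm (p + 1) d1 x.1 x.2.1 * goneTerm (q + 1) d2 x.2.2.1 x.2.2.2 =
      (d1 ! * d2 ! : ℚ) / ((d1 + d2 + 1)! : ℚ) * ((p + q).choose p : ℚ) *
          PowerSeries.coeff N (gone (p + q + 1) (d1 + d2 + 1)) +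
        (d1 ! * d2 ! : ℚ) * ((p + q).choose p : ℚ) *
          ∑ j ∈ Icc 1 (d1 + d2 + 1), lam (d1 + 1) (d2 + 1) j / ((j - 1)! : ℚ) *
            PowerSeries.coeff N (gone (p + q + 1) (j - 1)) := by
  rw [sum_quadruples_filter_eq N fun a b c d => goneTerm (p + 1) d1 a b * goneTerm (q + 1) d2 c d]
  simp_rw [coeff_gone _ _ N le_rfl, mul_sum]
  rw [sum_comm, ← sum_add_distrib]
  refine sum_congr rfl fun x hx => ?_
  obtain ⟨m, n⟩ := x
  have hm : 1 ≤ m := (mem_filter.1 hx).2.1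
  have hp : (p ! : ℚ) ≠ 0 := by exact_mod_cast Nat.factorial_ne_zero p
  have hq : (q ! : ℚ) ≠ 0 := by exact_mod_cast Nat.factorial_ne_zero q
  have hpq : ((p + q)! : ℚ) ≠ 0 := by exact_mod_cast Nat.factorial_ne_zero (p + q)
  have hsplit : ∑ a ∈ Ico 1 m, goneTerm (p + 1) d1 a n * goneTerm (q + 1) d2 (m - a) n =
      ((p + q).choose p : ℚ) * ((n : ℚ) ^ (p + q) / ((p + q)! : ℚ)) *
        ∑ a ∈ Ico 1 m, (a : ℚ) ^ d1 * ((m : ℚ) - a) ^ d2 := by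
    rw [mul_sum]
    refine sum_congr rfl fun a ha => ?_
    rw [mem_Ico] at ha
    simp only [goneTerm, Nat.add_sub_cancel, Nat.cast_sub ha.2.le, Nat.cast_add_choose]
    field_simp
    ring
  simp only
  rw [hsplit, sum_Ico_pow_mul_pow_eq_lam d1 d2 m hm, mul_add, mul_sum, mul_sum]
  simp only [goneTerm, Nat.add_sub_cancel]
  congr 1
  · ring
  · exact sum_congr rfl fun j _ => by ring

lemma sum_quadruples_trichotomy (N : ℕ) (f : ℕ × ℕ × ℕ × ℕ → ℚ) :
    ∑ x ∈ quadruples N, f x =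
      ∑ x ∈ (quadruples N).filter (fun x => x.2.1 < x.2.2.2), f x +
        ∑ x ∈ (quadruples N).filter (fun x => x.2.2.2 < x.2.1), f x +
        ∑ x ∈ (quadruples N).filter (fun x => x.2.1 = x.2.2.2), f x := by
  simp_rw [sum_filter, ← sum_add_distrib]
  refine sum_congr rfl fun x _ => ?_
  rcases lt_trichotomy x.2.1 x.2.2.2 with h | h | h
  · simp [h, h.ne, h.not_gt]
  · simp [h]
  · simp [h, h.ne', h.not_gt]

end ShuffleProduct

/-- the shuffle product analogue for the bi-indexed `q`-series `g`.
The sum over `l₁+l₂ = k₁+k₂`, `l₁,l₂ ≥ 1` is indexed by `l₁ ∈ [1, k₁+k₂-1]` with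
`l₂ = k₁+k₂-l₁`, and the sum over `e₁+e₂ = d₁+d₂`, `e₁,e₂ ≥ 0` by `e₁ ∈ [0, d₁+d₂]` with
`e₂ = d₁+d₂-e₁`.  (When `e₁ > dᵢ` the corresponding binomial coefficient `C(dᵢ,e₁)`
vanishes, so the truncated subtraction in the sign `(-1)^(dᵢ-e₁)` is harmless.) -/
theorem stmt_10 (k1 k2 d1 d2 : ℕ) (h1 : 1 ≤ k1) (h2 : 1 ≤ k2) :
    gone k1 d1 * gone k2 d2 =
      (∑ l1 ∈ Finset.Icc 1 (k1 + k2 - 1), ∑ e1 ∈ Finset.range (d1 + d2 + 1),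
        ((Nat.choose (l1 - 1) (k1 - 1) * Nat.choose d1 e1 : ℚ) * (-1 : ℚ) ^ (d1 - e1) +
            (Nat.choose (l1 - 1) (k2 - 1) * Nat.choose d2 e1 : ℚ) * (-1 : ℚ) ^ (d2 - e1)) •
          gtwo l1 (k1 + k2 - l1) e1 (d1 + d2 - e1)) +
      ((Nat.factorial d1 * Nat.factorial d2 : ℚ) / (Nat.factorial (d1 + d2 + 1)) *
          (Nat.choose (k1 + k2 - 2) (k1 - 1))) • gone (k1 + k2 - 1) (d1 + d2 + 1) +
      ((Nat.factorial d1 * Nat.factorial d2 : ℚ) * (Nat.choose (k1 + k2 - 2) (k1 - 1))) •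
        ∑ j ∈ Finset.Icc 1 (d1 + d2 + 1),
          (lam (d1 + 1) (d2 + 1) j / (Nat.factorial (j - 1))) • gone (k1 + k2 - 1) (j - 1) := by
  obtain ⟨p, rfl⟩ : ∃ p, k1 = p + 1 := ⟨k1 - 1, by omega⟩
  obtain ⟨q, rfl⟩ : ∃ q, k2 = q + 1 := ⟨k2 - 1, by omega⟩
  ext N
  have hsymm := sum_quadruples_filter_gt N fun a b c d =>
    goneTerm (p + 1) d1 a b * goneTerm (q + 1) d2 c d
  simp only [mul_comm (goneTerm (p + 1) d1 _ _)] at hsymm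
  rw [coeff_gone_mul_gone_s10, sum_quadruples_trichotomy]
  simp only [mul_comm (goneTerm (p + 1) d1 _ _)]
  rw [hsymm, sum_quadruples_lt_eq q p d2 d1 N]
  simp only [mul_comm (goneTerm (q + 1) d2 _ _)]
  rw [sum_quadruples_lt_eq p q d1 d2 N, sum_quadruples_eq_eq]
  simp only [map_add, map_sum, PowerSeries.coeff_smul, smul_eq_mul, add_mul,
    Finset.sum_add_distrib]
  rw [show p + 1 + (q + 1) - 1 = p + q + 1 by omega,
    show p + 1 + (q + 1) - 2 = p + q by omega, show p + 1 + (q + 1) = p + q + 2 by omega,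
    add_comm q p, add_comm d2 d1]
  simp only [Nat.add_sub_cancel, ← add_assoc]
end

section
/- Bernoulli realization of the double shuffle equations: for all real numbers x₁, x₂, y₁, y₂ such that x₁, x₂, y₁, y₂, x₁−x₂, x₁+x₂, y₁−y₂ and y₁+y₂ are all nonzero, the following two equalities hold: P_b(x₁,x₂;y₁,y₂) = b₂(x₁,x₂;y₁,y₂) + b₂(x₂,x₁;y₂,y₁) + (b₁(x₁;y₁+y₂) − b₁(x₂;y₁+y₂))/(x₁−x₂), and P_b(x₁,x₂;y₁,y₂) = b₂(x₁+x₂,x₂;y₁,y₂−y₁) + b₂(x₁+x₂,x₁;y₂,y₁−y₂) + (b₁(x₁+x₂;y₁) − b₁(x₁+x₂;y₂))/(y₁−y₂). -/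
/-- The hyperbolic cotangent `coth t = cosh t / sinh t`. -/
noncomputable def coth (t : ℝ) : ℝ := Real.cosh t / Real.sinh t

/-- `b₁(x;y) = -(1/4)(coth(x/2) + coth(y/2)) + (1/2)(1/x + 1/y)`. -/
noncomputable def b1 (x y : ℝ) : ℝ :=
  -(1 / 4) * (coth (x / 2) + coth (y / 2)) + (1 / 2) * (1 / x + 1 / y)

/-- `R*_b(x₁,x₂;y₁,y₂) = (b₁(x₁;y₁+y₂) - b₁(x₂;y₁+y₂))/(x₁-x₂)`. -/
noncomputable def Rast (x1 x2 y1 y2 : ℝ) : ℝ :=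
  (b1 x1 (y1 + y2) - b1 x2 (y1 + y2)) / (x1 - x2)

/-- `Rsh_b(x₁,x₂;y₁,y₂) = (b₁(x₁+x₂;y₁) - b₁(x₁+x₂;y₂))/(y₁-y₂)`. -/
noncomputable def Rsh (x1 x2 y1 y2 : ℝ) : ℝ :=
  (b1 (x1 + x2) y1 - b1 (x1 + x2) y2) / (y1 - y2)

/-- `P_b(x₁,x₂;y₁,y₂) = b₁(x₁;y₁)·b₁(x₂;y₂)`. -/
noncomputable def Pb (x1 x2 y1 y2 : ℝ) : ℝ := b1 x1 y1 * b1 x2 y2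

/-- The depth-two Bernoulli generating function `b₂`. -/
noncomputable def b2 (x1 x2 y1 y2 : ℝ) : ℝ :=
  (1 / 3) * Pb x1 x2 y1 y2 + (1 / 3) * Pb (x1 - x2) x2 y1 (y1 + y2)
    - (5 / 12) * Rsh (x1 - x2) x2 y1 (y1 + y2) - (1 / 12) * Rsh (-x2) x1 (-y2) y1
    + (1 / 4) * Rsh (x2 - x1) x1 y2 (y1 + y2)
    - (5 / 12) * Rast x1 x2 y1 y2 - (1 / 12) * Rast (x2 - x1) x2 (-y1) (y1 + y2)
    + (1 / 4) * Rast (x1 - x2) x1 (-y2) (y1 + y2)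


/-- The one-variable summand of `b1`. -/
noncomputable def bernoulliPart (x : ℝ) : ℝ := -(1 / 4) * coth (x / 2) + 1 / 2 * (1 / x)

theorem b1_eq_add (x y : ℝ) : b1 x y = bernoulliPart x + bernoulliPart y := by
  unfold b1 bernoulliPart
  ring

theorem bernoulliPart_neg (x : ℝ) : bernoulliPart (-x) = -bernoulliPart x := by
  simp only [bernoulliPart, coth, neg_div, Real.cosh_neg, Real.sinh_neg, div_neg]
  ring

/-- The addition formula for `coth`. -/
theorem coth_add_mul {a b : ℝ} (ha : a ≠ 0) (hb : b ≠ 0) (hab : a + b ≠ 0) :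
    coth (a + b) * (coth a + coth b) = coth a * coth b + 1 := by
  have ha' : Real.sinh a ≠ 0 := Real.sinh_ne_zero.mpr ha
  have hb' : Real.sinh b ≠ 0 := Real.sinh_ne_zero.mpr hb
  have hab' := Real.sinh_ne_zero.mpr hab
  unfold coth
  rw [Real.sinh_add] at hab'
  rw [Real.sinh_add, Real.cosh_add, div_mul_eq_mul_div, div_eq_iff hab']
  field_simp
  ring

theorem bernoulliPart_add_mul {a b : ℝ} (ha : a ≠ 0) (hb : b ≠ 0) (hab : a + b ≠ 0) :
    bernoulliPart (a + b) * (bernoulliPart a + bernoulliPart b)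
        - bernoulliPart a * bernoulliPart b =
      1 / 16 + 1 / 2 * (bernoulliPart (a + b) * (1 / a + 1 / b)
        + bernoulliPart a * (1 / (a + b) - 1 / b)
        + bernoulliPart b * (1 / (a + b) - 1 / a)) := by
  have h := coth_add_mul (a := a / 2) (b := b / 2) (by positivity) (by positivity)
    (by rw [← add_div]; positivity)
  rw [← add_div] at h
  unfold bernoulliPart
  generalize coth ((a + b) / 2) = C at *
  generalize coth (a / 2) = A at *
  generalize coth (b / 2) = B at *
  have hinv : 1 / (a + b) * (1 / a + 1 / b) = 1 / a * (1 / b) := by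
    field_simp
    ring
  linear_combination (1 / 16) * h - (1 / 4) * hinv

theorem b2_eq (x1 x2 y1 y2 : ℝ) :
    b2 x1 x2 y1 y2 =
      1 / 3 * ((bernoulliPart x1 + bernoulliPart y1) * (bernoulliPart x2 + bernoulliPart y2))
      + 1 / 3 * ((bernoulliPart (x1 - x2) + bernoulliPart y1)
          * (bernoulliPart x2 + bernoulliPart (y1 + y2)))
      + 5 / 12 * ((bernoulliPart y1 - bernoulliPart (y1 + y2)) / y2)
      - 1 / 12 * ((bernoulliPart y2 + bernoulliPart y1) / (y1 + y2))
      - 1 / 4 * ((bernoulliPart y2 - bernoulliPart (y1 + y2)) / y1)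
      - 5 / 12 * ((bernoulliPart x1 - bernoulliPart x2) / (x1 - x2))
      - 1 / 12 * ((bernoulliPart (x1 - x2) + bernoulliPart x2) / x1)
      - 1 / 4 * ((bernoulliPart (x1 - x2) - bernoulliPart x1) / x2) := by
  have hx : bernoulliPart (x2 - x1) = -bernoulliPart (x1 - x2) := by
    rw [← bernoulliPart_neg, neg_sub]
  simp only [b2, Pb, Rsh, Rast, b1_eq_add, sub_add_cancel, bernoulliPart_neg, hx,
    show -x2 + x1 = x1 - x2 by ring, show -y1 + (y1 + y2) = y2 by ring,
    show -y2 + (y1 + y2) = y1 by ring, show y1 - (y1 + y2) = -y2 by ring,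
    show y2 - (y1 + y2) = -y1 by ring, show -y2 - y1 = -(y1 + y2) by ring,
    show x2 - x1 - x2 = -x1 by ring, show x1 - x2 - x1 = -x2 by ring, div_neg]
  ring

/-- the Bernoulli realization of the double shuffle equations. -/
theorem stmt_12 (x1 x2 y1 y2 : ℝ) (hx1 : x1 ≠ 0) (hx2 : x2 ≠ 0) (hy1 : y1 ≠ 0) (hy2 : y2 ≠ 0)
    (hxm : x1 - x2 ≠ 0) (hxp : x1 + x2 ≠ 0) (hym : y1 - y2 ≠ 0) (hyp : y1 + y2 ≠ 0) :
    Pb x1 x2 y1 y2 =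
        b2 x1 x2 y1 y2 + b2 x2 x1 y2 y1 + (b1 x1 (y1 + y2) - b1 x2 (y1 + y2)) / (x1 - x2) ∧
      Pb x1 x2 y1 y2 =
        b2 (x1 + x2) x2 y1 (y2 - y1) + b2 (x1 + x2) x1 y2 (y1 - y2) +
          (b1 (x1 + x2) y1 - b1 (x1 + x2) y2) / (y1 - y2) := by
  constructor
  · have hx := bernoulliPart_add_mul hxm hx2 (by simpa using hx1)
    have hy := bernoulliPart_add_mul hy1 hy2 hyp
    rw [sub_add_cancel] at hx
    simp only [b2_eq, Pb, b1_eq_add, add_comm y2 y1, show x2 - x1 = -(x1 - x2) by ring,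
      div_neg, bernoulliPart_neg]
    linear_combination (1 / 3) * hx - (1 / 3) * hy
  · have hx := bernoulliPart_add_mul hx1 hx2 hxp
    have hy := bernoulliPart_add_mul hy1 (sub_ne_zero.mpr (sub_ne_zero.mp hym).symm)
      (by simpa using hy2)
    rw [add_sub_cancel] at hy
    simp only [b2_eq, Pb, b1_eq_add, add_sub_cancel, add_sub_cancel_right,
      add_sub_cancel_left, show y1 - y2 = -(y2 - y1) by ring,
      show y2 + -(y2 - y1) = y1 by ring,
      div_neg, bernoulliPart_neg]
    linear_combination -(1 / 3) * hx + (1 / 3) * hy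
end

section
/- Fix an integer k ≥ 1. The assignment Z_k ↦ G(k;0) − δ_{k,2}·G(2;0); Z_{k_1,k_2} ↦ G(k_1,k_2;0,0) + (1/2)·(δ_{k_2,1}·G(k_1;1) − δ_{k_1,1}·G(k_2;1) + δ_{k_1,2}·G(k_2+1;1)); P_{k_1,k_2} ↦ P(k_1,k_2;0,0) + (1/2)·(δ_{k_1,2}·G(k_2+1;1) + δ_{k_2,2}·G(k_1+1;1)) − δ_{k_1,1}δ_{k_2,1}·G(2;0) (for k_1+k_2 = k, k_1,k_2 ≥ 1) induces a well-defined ℚ-linear map from the formal double zeta space D_k to the formal double Eisenstein space E_k; that is, the images of the defining relation vectors of D_k lie in the span of the defining relation vectors of E_k. -/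
open scoped Classical

/-- Generators of the formal double zeta space `D_k`: the symbol `Z_k`, and the symbols
`Z_{k₁,k₂}`, `P_{k₁,k₂}` for `k₁,k₂ ≥ 1` with `k₁+k₂ = k`. -/
inductive DGen (k : ℕ) : Type where
  | Z : DGen k
  | ZZ : (k1 k2 : ℕ) → 1 ≤ k1 → 1 ≤ k2 → k1 + k2 = k → DGen k
  | P : (k1 k2 : ℕ) → 1 ≤ k1 → 1 ≤ k2 → k1 + k2 = k → DGen k

/-- Generators of the formal double Eisenstein space `E_k`: the symbols `G(a;d)` for
`a ≥ 1`, `a+d = k`, and the symbols `G(k₁,k₂;d₁,d₂)`, `P(k₁,k₂;d₁,d₂)` for `k₁,k₂ ≥ 1`,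
`d₁,d₂ ≥ 0` with `k₁+k₂+d₁+d₂ = k`. -/
inductive EGen (k : ℕ) : Type where
  | G : (a d : ℕ) → 1 ≤ a → a + d = k → EGen k
  | GG : (k1 k2 d1 d2 : ℕ) → 1 ≤ k1 → 1 ≤ k2 → k1 + k2 + d1 + d2 = k → EGen k
  | P : (k1 k2 d1 d2 : ℕ) → 1 ≤ k1 → 1 ≤ k2 → k1 + k2 + d1 + d2 = k → EGen k

/-- The stuffle relation vector `P_{k₁,k₂} - Z_{k₁,k₂} - Z_{k₂,k₁} - Z_k` of `D_k`. -/
noncomputable def relD1 (k k1 k2 : ℕ) (h1 : 1 ≤ k1) (h2 : 1 ≤ k2) (hs : k1 + k2 = k) :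
    DGen k →₀ ℚ :=
  Finsupp.single (DGen.P k1 k2 h1 h2 hs) 1 - Finsupp.single (DGen.ZZ k1 k2 h1 h2 hs) 1 -
    Finsupp.single (DGen.ZZ k2 k1 h2 h1 (by omega)) 1 - Finsupp.single DGen.Z 1

/-- The shuffle relation vector
`P_{k₁,k₂} - ∑_{j=1}^{k-1} (C(j-1,k₁-1) + C(j-1,k₂-1))·Z_{j,k-j}` of `D_k`. -/
noncomputable def relD2 (k k1 k2 : ℕ) (h1 : 1 ≤ k1) (h2 : 1 ≤ k2) (hs : k1 + k2 = k) :
    DGen k →₀ ℚ :=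
  Finsupp.single (DGen.P k1 k2 h1 h2 hs) 1 -
    ∑ j ∈ (Finset.Icc 1 (k - 1)).attach,
      ((Nat.choose (j.1 - 1) (k1 - 1) + Nat.choose (j.1 - 1) (k2 - 1) : ℚ)) •
        Finsupp.single (DGen.ZZ j.1 (k - j.1)
          (by have := Finset.mem_Icc.mp j.2; omega)
          (by have := Finset.mem_Icc.mp j.2; omega)
          (by have := Finset.mem_Icc.mp j.2; omega)) 1

/-- The set of defining relation vectors of the formal double zeta space `D_k`. -/
noncomputable def DRels (k : ℕ) : Set (DGen k →₀ ℚ) :=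
  {v | ∃ (k1 k2 : ℕ) (h1 : 1 ≤ k1) (h2 : 1 ≤ k2) (hs : k1 + k2 = k),
    v = relD1 k k1 k2 h1 h2 hs ∨ v = relD2 k k1 k2 h1 h2 hs}

/-- The stuffle relation vector
`P(k₁,k₂;d₁,d₂) - G(k₁,k₂;d₁,d₂) - G(k₂,k₁;d₂,d₁) - G(k₁+k₂;d₁+d₂)` of `E_k`. -/
noncomputable def relE1 (k k1 k2 d1 d2 : ℕ) (h1 : 1 ≤ k1) (h2 : 1 ≤ k2)
    (hs : k1 + k2 + d1 + d2 = k) : EGen k →₀ ℚ :=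
  Finsupp.single (EGen.P k1 k2 d1 d2 h1 h2 hs) 1 -
    Finsupp.single (EGen.GG k1 k2 d1 d2 h1 h2 hs) 1 -
    Finsupp.single (EGen.GG k2 k1 d2 d1 h2 h1 (by omega)) 1 -
    Finsupp.single (EGen.G (k1 + k2) (d1 + d2) (by omega) (by omega)) 1

/-- The shuffle relation vector of `E_k`:
`P(k₁,k₂;d₁,d₂) - ∑_{l₁+l₂=k₁+k₂, e₁+e₂=d₁+d₂} (C(l₁-1,k₁-1)C(d₁,e₁)(-1)^{d₁-e₁}
+ C(l₁-1,k₂-1)C(d₂,e₁)(-1)^{d₂-e₁})·G(l₁,l₂;e₁,e₂)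
- (d₁!d₂!/(d₁+d₂+1)!)·C(k₁+k₂-2,k₁-1)·G(k₁+k₂-1;d₁+d₂+1)`.
(When `e₁ > dᵢ` the binomial `C(dᵢ,e₁)` vanishes, so the truncated subtraction in the
sign `(-1)^{dᵢ-e₁}` is harmless.) -/
noncomputable def relE2 (k k1 k2 d1 d2 : ℕ) (h1 : 1 ≤ k1) (h2 : 1 ≤ k2)
    (hs : k1 + k2 + d1 + d2 = k) : EGen k →₀ ℚ :=
  Finsupp.single (EGen.P k1 k2 d1 d2 h1 h2 hs) 1 -
    (∑ l1 ∈ (Finset.Icc 1 (k1 + k2 - 1)).attach, ∑ e1 ∈ (Finset.range (d1 + d2 + 1)).attach,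
      ((Nat.choose (l1.1 - 1) (k1 - 1) * Nat.choose d1 e1.1 : ℚ) * (-1 : ℚ) ^ (d1 - e1.1) +
          (Nat.choose (l1.1 - 1) (k2 - 1) * Nat.choose d2 e1.1 : ℚ) * (-1 : ℚ) ^ (d2 - e1.1)) •
        Finsupp.single (EGen.GG l1.1 (k1 + k2 - l1.1) e1.1 (d1 + d2 - e1.1)
          (by have := Finset.mem_Icc.mp l1.2; omega)
          (by have := Finset.mem_Icc.mp l1.2; omega)
          (by have := Finset.mem_Icc.mp l1.2; have := Finset.mem_range.mp e1.2; omega)) 1) -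
    ((Nat.factorial d1 * Nat.factorial d2 : ℚ) / (Nat.factorial (d1 + d2 + 1)) *
        (Nat.choose (k1 + k2 - 2) (k1 - 1))) •
      Finsupp.single (EGen.G (k1 + k2 - 1) (d1 + d2 + 1) (by omega) (by omega)) 1

/-- The set of defining relation vectors of the formal double Eisenstein space `E_k`. -/
noncomputable def ERels (k : ℕ) : Set (EGen k →₀ ℚ) :=
  {v | ∃ (k1 k2 d1 d2 : ℕ) (h1 : 1 ≤ k1) (h2 : 1 ≤ k2) (hs : k1 + k2 + d1 + d2 = k),
    v = relE1 k k1 k2 d1 d2 h1 h2 hs ∨ v = relE2 k k1 k2 d1 d2 h1 h2 hs}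

/-- The assignment on generators: `Z_k ↦ G(k;0) - δ_{k,2}·G(2;0)`,
`Z_{k₁,k₂} ↦ G(k₁,k₂;0,0) + (1/2)(δ_{k₂,1}·G(k₁;1) - δ_{k₁,1}·G(k₂;1) + δ_{k₁,2}·G(k₂+1;1))`,
`P_{k₁,k₂} ↦ P(k₁,k₂;0,0) + (1/2)(δ_{k₁,2}·G(k₂+1;1) + δ_{k₂,2}·G(k₁+1;1))
- δ_{k₁,1}δ_{k₂,1}·G(2;0)`. -/
noncomputable def phi (k : ℕ) (hk : 1 ≤ k) : DGen k → (EGen k →₀ ℚ)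
  | DGen.Z =>
      Finsupp.single (EGen.G k 0 hk (by omega)) 1 -
        (if h : k = 2 then Finsupp.single (EGen.G 2 0 (by omega) (by omega)) 1 else 0)
  | DGen.ZZ k1 k2 h1 h2 hs =>
      Finsupp.single (EGen.GG k1 k2 0 0 h1 h2 (by omega)) 1 +
        (1 / 2 : ℚ) •
          ((if h : k2 = 1 then Finsupp.single (EGen.G k1 1 h1 (by omega)) 1 else 0) -
            (if h : k1 = 1 then Finsupp.single (EGen.G k2 1 h2 (by omega)) 1 else 0) +
            (if h : k1 = 2 then
              Finsupp.single (EGen.G (k2 + 1) 1 (by omega) (by omega)) 1 else 0))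
  | DGen.P k1 k2 h1 h2 hs =>
      Finsupp.single (EGen.P k1 k2 0 0 h1 h2 (by omega)) 1 +
        (1 / 2 : ℚ) •
          ((if h : k1 = 2 then
              Finsupp.single (EGen.G (k2 + 1) 1 (by omega) (by omega)) 1 else 0) +
            (if h : k2 = 2 then
              Finsupp.single (EGen.G (k1 + 1) 1 (by omega) (by omega)) 1 else 0)) -
        (if h : k1 = 1 ∧ k2 = 1 then
          Finsupp.single (EGen.G 2 0 (by omega) (by omega)) 1 else 0)

/-- The image of a stuffle relation of `D_k` is the corresponding stuffle relation of `E_k`. -/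
lemma linearCombination_phi_relD1 (k : ℕ) (hk : 1 ≤ k) (k1 k2 : ℕ) (h1 : 1 ≤ k1) (h2 : 1 ≤ k2)
    (hs : k1 + k2 = k) :
    Finsupp.linearCombination ℚ (phi k hk) (relD1 k k1 k2 h1 h2 hs) =
      relE1 k k1 k2 0 0 h1 h2 hs := by
  subst hs
  have hiff : (k1 + k2 = 2) ↔ (k1 = 1 ∧ k2 = 1) := by omega
  simp only [relD1, relE1, map_sub, Finsupp.linearCombination_single, one_smul, phi, hiff, add_zero]
  module

/-- The value of `phi` on `Z_{k₁,k₂}`, with its correction terms collected as a multiple of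
`G(k-1;1)`. -/
lemma phi_ZZ_eq_smul (k : ℕ) (hk : 2 ≤ k) (k1 k2 : ℕ) (h1 : 1 ≤ k1) (h2 : 1 ≤ k2)
    (hs : k1 + k2 = k) :
    phi k (by omega) (DGen.ZZ k1 k2 h1 h2 hs) =
      Finsupp.single (EGen.GG k1 k2 0 0 h1 h2 hs) 1 +
        ((1 / 2 : ℚ) * ((if k1 = k - 1 then 1 else 0) - (if k1 = 1 then 1 else 0) +
          (if k1 = 2 then 1 else 0))) •
          Finsupp.single (EGen.G (k - 1) 1 (by omega) (by omega)) (1 : ℚ) := by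
  have e1 : (if h : k2 = 1 then Finsupp.single (EGen.G (k := k) k1 1 h1 (by omega)) (1 : ℚ) else 0)
      = (if k1 = k - 1 then (1 : ℚ) else 0) •
        Finsupp.single (EGen.G (k - 1) 1 (by omega) (by omega)) (1 : ℚ) := by
    split_ifs with h h' h'
    · subst h'; rw [one_smul]
    · omega
    · omega
    · rw [zero_smul]
  have e2 : (if h : k1 = 1 then Finsupp.single (EGen.G (k := k) k2 1 h2 (by omega)) (1 : ℚ) else 0)
      = (if k1 = 1 then (1 : ℚ) else 0) •
        Finsupp.single (EGen.G (k - 1) 1 (by omega) (by omega)) (1 : ℚ) := by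
    split_ifs with h
    · obtain rfl : k2 = k - 1 := by omega
      rw [one_smul]
    · rw [zero_smul]
  have e3 : (if h : k1 = 2 then
        Finsupp.single (EGen.G (k := k) (k2 + 1) 1 (by omega) (by omega)) (1 : ℚ) else 0)
      = (if k1 = 2 then (1 : ℚ) else 0) •
        Finsupp.single (EGen.G (k - 1) 1 (by omega) (by omega)) (1 : ℚ) := by
    split_ifs with h
    · have : k2 + 1 = k - 1 := by omega
      simp only [this, one_smul]
    · rw [zero_smul]
  simp only [phi]
  rw [e1, e2, e3]
  module

/-- The value of `phi` on `P_{k₁,k₂}`, with its correction terms of depth one and derivative one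
collected as a multiple of `G(k-1;1)`. -/
lemma phi_P_eq_smul (k : ℕ) (hk : 2 ≤ k) (k1 k2 : ℕ) (h1 : 1 ≤ k1) (h2 : 1 ≤ k2)
    (hs : k1 + k2 = k) :
    phi k (by omega) (DGen.P k1 k2 h1 h2 hs) =
      Finsupp.single (EGen.P k1 k2 0 0 h1 h2 hs) 1 +
        ((1 / 2 : ℚ) * ((if k1 = 2 then 1 else 0) + (if k2 = 2 then 1 else 0))) •
          Finsupp.single (EGen.G (k - 1) 1 (by omega) (by omega)) (1 : ℚ) -
        (if h : k = 2 then Finsupp.single (EGen.G 2 0 (by omega) (by omega)) 1 else 0) := by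
  have e (a b : ℕ) (ha : 1 ≤ a) (hb : 1 ≤ b) (hab : a + b = k) : (if h : a = 2 then
        Finsupp.single (EGen.G (k := k) (b + 1) 1 (by omega) (by omega)) (1 : ℚ) else 0)
      = (if a = 2 then (1 : ℚ) else 0) •
        Finsupp.single (EGen.G (k - 1) 1 (by omega) (by omega)) (1 : ℚ) := by
    split_ifs with h
    · have : b + 1 = k - 1 := by omega
      simp only [this, one_smul]
    · rw [zero_smul]
  have hiff : (k1 = 1 ∧ k2 = 1) ↔ k = 2 := by omega
  simp only [phi, hiff]
  rw [e k1 k2 h1 h2 hs, e k2 k1 h2 h1 (by omega)]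
  module

/-- The shuffle relation of `E_k` without derivatives, as a single sum. -/
lemma relE2_zero_zero (k k1 k2 : ℕ) (h1 : 1 ≤ k1) (h2 : 1 ≤ k2) (hs : k1 + k2 = k) :
    relE2 k k1 k2 0 0 h1 h2 hs =
      Finsupp.single (EGen.P k1 k2 0 0 h1 h2 hs) 1 -
      (∑ j ∈ (Finset.Icc 1 (k - 1)).attach,
        ((Nat.choose (j.1 - 1) (k1 - 1) + Nat.choose (j.1 - 1) (k2 - 1) : ℚ)) •
          Finsupp.single (EGen.GG j.1 (k - j.1) 0 0
            (by have := Finset.mem_Icc.mp j.2; omega)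
            (by have := Finset.mem_Icc.mp j.2; omega)
            (by have := Finset.mem_Icc.mp j.2; omega)) 1) -
      (Nat.choose (k - 2) (k1 - 1) : ℚ) •
        Finsupp.single (EGen.G (k - 1) 1 (by omega) (by omega)) 1 := by
  subst hs
  unfold relE2
  congr 1
  · congr 1
    refine Finset.sum_congr rfl fun j _ => ?_
    rw [Finset.sum_eq_single ⟨0, by simp⟩]
    · simp
    · rintro ⟨b, hb⟩ _ hne
      exact absurd (Subtype.ext (by simpa using hb)) hne
    · intro h
      exact absurd (Finset.mem_attach _ _) h
  · simp

/-- Summing the shuffle coefficients against the depth-one corrections of `phi` on the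
`Z_{j,k-j}`. -/
lemma sum_choose_mul_correction (k k1 k2 : ℕ) (hk : 3 ≤ k) (h1 : 1 ≤ k1) (h2 : 1 ≤ k2)
    (hs : k1 + k2 = k) :
    ∑ j ∈ Finset.Icc 1 (k - 1),
      ((Nat.choose (j - 1) (k1 - 1) + Nat.choose (j - 1) (k2 - 1) : ℚ)) *
        ((1 / 2 : ℚ) * ((if j = k - 1 then 1 else 0) - (if j = 1 then 1 else 0) +
          (if j = 2 then 1 else 0))) =
      Nat.choose (k - 2) (k1 - 1) +
        (1 / 2 : ℚ) * ((if k1 = 2 then 1 else 0) + (if k2 = 2 then 1 else 0)) := by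
  have hsymm : Nat.choose (k - 2) (k2 - 1) = Nat.choose (k - 2) (k1 - 1) :=
    Nat.choose_symm_of_eq_add (by omega)
  have hm1 : 1 ∈ Finset.Icc 1 (k - 1) := by simp; omega
  have hm2 : 2 ∈ Finset.Icc 1 (k - 1) := by simp; omega
  have hm3 : k - 1 ∈ Finset.Icc 1 (k - 1) := by simp; omega
  simp only [mul_add, mul_sub, mul_ite, mul_one, mul_zero, Finset.sum_add_distrib,
    Finset.sum_sub_distrib, Finset.sum_ite_eq', hm1, hm2, hm3, if_true]
  rw [show k - 1 - 1 = k - 2 by omega, hsymm]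
  have hdiff (a : ℕ) (ha : 1 ≤ a) : (Nat.choose (2 - 1) (a - 1) : ℚ) =
      Nat.choose (1 - 1) (a - 1) + if a = 2 then 1 else 0 := by
    obtain ⟨b, rfl⟩ := Nat.exists_eq_add_of_le' ha
    rcases b with _ | _ | b <;> simp [Nat.choose_eq_zero_of_lt]
  rw [hdiff k1 h1, hdiff k2 h2]
  split_ifs <;> ring

/-- In weight at least three, the image of a shuffle relation of `D_k` is the corresponding
shuffle relation of `E_k`. -/
lemma linearCombination_phi_relD2 (k : ℕ) (hk : 3 ≤ k) (k1 k2 : ℕ) (h1 : 1 ≤ k1) (h2 : 1 ≤ k2)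
    (hs : k1 + k2 = k) :
    Finsupp.linearCombination ℚ (phi k (by omega)) (relD2 k k1 k2 h1 h2 hs) =
      relE2 k k1 k2 0 0 h1 h2 hs := by
  have hsum := sum_choose_mul_correction k k1 k2 hk h1 h2 hs
  rw [← Finset.sum_attach] at hsum
  have hsmul := congrArg
    (· • Finsupp.single (EGen.G (k := k) (k - 1) 1 (by omega) (by omega)) (1 : ℚ)) hsum
  simp only [Finset.sum_smul] at hsmul
  rw [relE2_zero_zero]
  simp only [relD2, map_sub, map_sum, map_smul, Finsupp.linearCombination_single, one_smul]
  simp only [phi_ZZ_eq_smul k (by omega), phi_P_eq_smul k (by omega), smul_add, smul_smul,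
    Finset.sum_add_distrib]
  rw [hsmul, dif_neg (by omega)]
  module

/-- In weight two, the image of the shuffle relation of `D_2` is the stuffle relation of `E_2`. -/
lemma linearCombination_phi_relD2_two (k : ℕ) (hk : k = 2) (k1 k2 : ℕ) (h1 : 1 ≤ k1) (h2 : 1 ≤ k2)
    (hs : k1 + k2 = k) :
    Finsupp.linearCombination ℚ (phi k (by omega)) (relD2 k k1 k2 h1 h2 hs) =
      relE1 k k1 k2 0 0 h1 h2 hs := by
  obtain rfl : k1 = 1 := by omega
  obtain rfl : k2 = 1 := by omega
  subst hk
  have hmem : (1 : ℕ) ∈ Finset.Icc 1 (2 - 1) := by simp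
  have hsum (f : {x // x ∈ Finset.Icc 1 (2 - 1)} → (EGen 2 →₀ ℚ)) :
      ∑ j ∈ (Finset.Icc 1 (2 - 1)).attach, f j = f ⟨1, hmem⟩ := by
    refine Finset.sum_eq_single _ ?_ fun h => absurd (Finset.mem_attach _ _) h
    rintro ⟨b, hb⟩ _ hne
    exact absurd (Subtype.ext (by have := Finset.mem_Icc.mp hb; simp; omega)) hne
  simp only [relD2, relE1, map_sub, map_sum, map_smul, Finsupp.linearCombination_single, one_smul]
  rw [hsum]
  simp [phi]
  module

/-- the assignment `phi`, extended `ℚ`-linearly to the free `ℚ`-vector space on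
the generators of `D_k`, maps every defining relation vector of `D_k` into the span of the
defining relation vectors of `E_k`; hence it induces a well-defined `ℚ`-linear map
`D_k → E_k`. -/
theorem stmt_14 (k : ℕ) (hk : 1 ≤ k) :
    ∀ v ∈ DRels k,
      Finsupp.linearCombination ℚ (phi k hk) v ∈ Submodule.span ℚ (ERels k) := by
  rintro v ⟨k1, k2, h1, h2, hs, rfl | rfl⟩
  · rw [linearCombination_phi_relD1]
    exact Submodule.subset_span ⟨k1, k2, 0, 0, h1, h2, hs, Or.inl rfl⟩
  · by_cases h : k = 2
    · rw [linearCombination_phi_relD2_two k h]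
      exact Submodule.subset_span ⟨k1, k2, 0, 0, h1, h2, hs, Or.inl rfl⟩
    · rw [linearCombination_phi_relD2 k (by omega)]
      exact Submodule.subset_span ⟨k1, k2, 0, 0, h1, h2, hs, Or.inr rfl⟩
end
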